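/- arXiv:1805.06004 — 10 statements merged into one kernel-verified Lean document; each statement's English description precedes it below -/
import Mathlib

section
/- Let 1 ≤ k ≤ n. A k-dimensional ℂ-linear subspace V of ℂⁿ satisfies σ(V) = V if and only if there exists a set S of k distinct complex numbers with z^n = (−1)^{k−1} for every z ∈ S such that V = V_S. -/
open scoped BigOperators

/-- The `t`-deformed left cyclic shift map on `ℂⁿ`:
`σ_t(v₁,…,vₙ) = (v₂,…,vₙ,(−1)^{k−1} t v₁)`. -/
noncomputable def cycShift (k n : ℕ) (t : ℂ) : (Fin n → ℂ) →ₗ[ℂ] (Fin n → ℂ) where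
  toFun v := fun i =>
    if h : (i : ℕ) + 1 < n then v ⟨(i : ℕ) + 1, h⟩ else (-1 : ℂ) ^ (k - 1) * t * v ⟨0, i.pos⟩
  map_add' u v := by
    funext i
    by_cases h : (i : ℕ) + 1 < n <;> simp [h, mul_add]
  map_smul' c v := by
    funext i
    by_cases h : (i : ℕ) + 1 < n <;> simp [h, mul_comm, mul_left_comm, mul_assoc]

/-- `V_S`: the span in `ℂⁿ` of the vectors `(1, z, …, z^{n-1})` for `z ∈ S`. -/
noncomputable def VS (n : ℕ) (S : Finset ℂ) : Submodule ℂ (Fin n → ℂ) :=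
  Submodule.span ℂ ((fun z : ℂ => fun j : Fin n => z ^ (j : ℕ)) '' (S : Set ℂ))

/-- `S₀`: the `k` n-th roots of `(−1)^{k−1}` closest to `1` on the unit circle. -/
noncomputable def S0 (k n : ℕ) : Finset ℂ :=
  Finset.image
    (fun j : Fin k => Complex.exp (Complex.I * ((2 * (j : ℝ) + 1 - k) * Real.pi / n)))
    Finset.univ

/-- The rows of a real `k × n` matrix, viewed as vectors in `ℂⁿ`. -/
def rowsC {k n : ℕ} (A : Matrix (Fin k) (Fin n) ℝ) : Fin k → (Fin n → ℂ) :=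
  fun p j => (A p j : ℂ)

/-- A subspace `V ⊆ ℂⁿ` is totally nonnegative if it has a basis given by the rows
of a real `k × n` matrix all of whose `k × k` minors (columns in increasing order)
are nonnegative. -/
def IsTotallyNonneg (k n : ℕ) (V : Submodule ℂ (Fin n → ℂ)) : Prop :=
  ∃ A : Matrix (Fin k) (Fin n) ℝ,
    LinearIndependent ℂ (rowsC A) ∧
    Submodule.span ℂ (Set.range (rowsC A)) = V ∧
    ∀ g : Fin k → Fin n, StrictMono g → 0 ≤ (A.submatrix id g).det

/-- Totally positive subspaces: as above but with strictly positive minors. -/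
def IsTotallyPos (k n : ℕ) (V : Submodule ℂ (Fin n → ℂ)) : Prop :=
  ∃ A : Matrix (Fin k) (Fin n) ℝ,
    LinearIndependent ℂ (rowsC A) ∧
    Submodule.span ℂ (Set.range (rowsC A)) = V ∧
    ∀ g : Fin k → Fin n, StrictMono g → 0 < (A.submatrix id g).det

theorem cycShift_pow_apply (k n : ℕ) (t : ℂ) (v : Fin n → ℂ) (i : Fin n) (j : ℕ) (hj : j ≤ n) :
    ((cycShift k n t) ^ j) v i =
      if h : (i : ℕ) + j < n then v ⟨i + j, h⟩
      else (-1 : ℂ) ^ (k - 1) * t * v ⟨i + j - n, by omega⟩ := by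
  induction j generalizing v with
  | zero => simp
  | succ j ih =>
    rw [pow_succ, Module.End.mul_apply, ih _ (by omega)]
    simp only [cycShift, LinearMap.coe_mk, AddHom.coe_mk]
    split_ifs
    all_goals first
      | omega
      | rfl
      | (congr 2; rw [Fin.mk.injEq]; omega)

theorem cycShift_pow_card (k n : ℕ) (t : ℂ) :
    (cycShift k n t) ^ n = algebraMap ℂ (Module.End ℂ (Fin n → ℂ)) ((-1 : ℂ) ^ (k - 1) * t) := by
  refine LinearMap.ext fun v => funext fun i => ?_
  rw [Module.algebraMap_end_apply, cycShift_pow_apply k n t v i n le_rfl]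
  simp

theorem cycShift_isSemisimple (k n : ℕ) (hn : n ≠ 0) {t : ℂ} (ht : t ≠ 0) :
    Module.End.IsSemisimple (cycShift k n t) := by
  refine Module.End.isSemisimple_of_squarefree_aeval_eq_zero
    (p := Polynomial.X ^ n - Polynomial.C ((-1 : ℂ) ^ (k - 1) * t)) ?_ ?_
  · exact (Polynomial.separable_X_pow_sub_C _ (by exact_mod_cast hn) (by simp [ht])).squarefree
  · simp [cycShift_pow_card]

/-- The vector `(1, z, …, z^{n-1})`. -/
def powVec (n : ℕ) (z : ℂ) : Fin n → ℂ := fun j => z ^ (j : ℕ)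

theorem VS_eq_span (n : ℕ) (S : Finset ℂ) :
    VS n S = Submodule.span ℂ (Set.range fun z : S => powVec n z) := by
  rw [VS, Set.image_eq_range]
  rfl

theorem cycShift_powVec (k n : ℕ) {t z : ℂ} (hz : z ^ n = (-1 : ℂ) ^ (k - 1) * t) :
    cycShift k n t (powVec n z) = z • powVec n z := by
  funext i
  simp only [cycShift, powVec, LinearMap.coe_mk, AddHom.coe_mk, Pi.smul_apply, smul_eq_mul]
  split_ifs with h
  · rw [pow_succ']
  · rw [← pow_succ', show (i : ℕ) + 1 = n by omega, hz]
    simp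

theorem powVec_ne_zero {n : ℕ} (hn : 0 < n) (z : ℂ) : powVec n z ≠ 0 := fun h => by
  simpa [powVec] using congrFun h ⟨0, hn⟩

theorem finrank_VS (k n : ℕ) (hn : 0 < n) {t : ℂ} {S : Finset ℂ}
    (hS : ∀ z ∈ S, z ^ n = (-1 : ℂ) ^ (k - 1) * t) : Module.finrank ℂ (VS n S) = S.card := by
  rw [VS_eq_span, finrank_span_eq_card, Fintype.card_coe]
  refine Module.End.eigenvectors_linearIndependent' (cycShift k n t) (fun z : S => (z : ℂ))
    Subtype.val_injective _ fun z => ?_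
  exact Module.End.hasEigenvector_iff.2
    ⟨Module.End.mem_eigenspace_iff.2 (cycShift_powVec k n (hS z z.2)), powVec_ne_zero hn z⟩

theorem eq_smul_powVec_of_cycShift_eq (k n : ℕ) (hn : 0 < n) {t z : ℂ} {v : Fin n → ℂ}
    (hv : cycShift k n t v = z • v) : v = v ⟨0, hn⟩ • powVec n z := by
  funext ⟨i, hi⟩
  induction i with
  | zero => simp [powVec]
  | succ i ih =>
    have h := congrFun hv ⟨i, by omega⟩
    simp only [cycShift, LinearMap.coe_mk, AddHom.coe_mk, hi, dite_true, Pi.smul_apply] at h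
    rw [h, ih (by omega)]
    simp only [powVec, Pi.smul_apply, smul_eq_mul]
    ring

theorem pow_eq_of_cycShift_eq (k n : ℕ) {t z : ℂ} {v : Fin n → ℂ} (hv0 : v ≠ 0)
    (hv : cycShift k n t v = z • v) : z ^ n = (-1 : ℂ) ^ (k - 1) * t := by
  have h := (Module.End.hasEigenvector_iff.2
    ⟨Module.End.mem_eigenspace_iff.2 hv, hv0⟩).pow_apply n
  rw [cycShift_pow_card, Module.algebraMap_end_apply] at h
  exact (smul_left_injective ℂ hv0 h).symm

theorem eq_VS_of_cycShift_invariant (k n : ℕ) (hn : 0 < n) {t : ℂ} (ht : t ≠ 0)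
    {V : Submodule ℂ (Fin n → ℂ)} (hV : ∀ v ∈ V, cycShift k n t v ∈ V) :
    ∃ S : Finset ℂ, (∀ z ∈ S, z ^ n = (-1 : ℂ) ^ (k - 1) * t) ∧ V = VS n S := by
  classical
  set c : ℂ := (-1 : ℂ) ^ (k - 1) * t
  let S : Finset ℂ := (Polynomial.nthRootsFinset n c).filter fun z => powVec n z ∈ V
  have hS : ∀ z, z ∈ S ↔ z ^ n = c ∧ powVec n z ∈ V := fun z => by
    simp [S, Polynomial.mem_nthRootsFinset hn]
  refine ⟨S, fun z hz => ((hS z).1 hz).1, le_antisymm ?_ ?_⟩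
  · have htop : ⨆ μ, Module.End.genEigenspace (cycShift k n t) μ 1 = ⊤ :=
      (cycShift_isSemisimple k n hn.ne' ht).iSup_eigenspace_eq_top
    rw [Submodule.eq_iSup_inf_genEigenspace 1 hV htop]
    refine iSup_le fun μ v hv => ?_
    by_cases hv0 : v = 0
    · simp [hv0]
    have hμ : cycShift k n t v = μ • v := Module.End.mem_eigenspace_iff.1 hv.2
    have hvp := eq_smul_powVec_of_cycShift_eq k n hn hμ
    have hv00 : v ⟨0, hn⟩ ≠ 0 := fun h => hv0 (by rw [hvp, h, zero_smul])
    rw [hvp]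
    refine Submodule.smul_mem _ _ (Submodule.subset_span ⟨μ, ?_, rfl⟩)
    refine (hS μ).2 ⟨pow_eq_of_cycShift_eq k n hv0 hμ, ?_⟩
    have := hv.1
    rw [hvp] at this
    exact (Submodule.smul_mem_iff _ hv00).1 this
  · rw [VS_eq_span, Submodule.span_le]
    rintro _ ⟨z, rfl⟩
    exact ((hS z).1 z.2).2

theorem map_cycShift_VS (k n : ℕ) {t : ℂ} {S : Finset ℂ}
    (hS : ∀ z ∈ S, z ^ n = (-1 : ℂ) ^ (k - 1) * t) (ht : t ≠ 0) (hn : n ≠ 0) :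
    Submodule.map (cycShift k n t) (VS n S) = VS n S := by
  rw [VS_eq_span, Submodule.map_span]
  apply le_antisymm <;> rw [Submodule.span_le]
  · rintro _ ⟨_, ⟨z, rfl⟩, rfl⟩
    rw [cycShift_powVec k n (hS z z.2)]
    exact Submodule.smul_mem _ _ (Submodule.subset_span ⟨z, rfl⟩)
  · rintro _ ⟨z, rfl⟩
    have hz : (z : ℂ) ≠ 0 := fun h => by
      have := hS z z.2
      simp [h, hn, ht] at this
    refine (Submodule.smul_mem_iff _ hz).1 ?_
    rw [← cycShift_powVec k n (hS z z.2)]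
    exact Submodule.subset_span ⟨_, ⟨z, rfl⟩, rfl⟩

/-- For `1 ≤ k ≤ n`, a `k`-dimensional subspace `V ⊆ ℂⁿ` satisfies
`σ(V) = V` iff `V = V_S` for a set `S` of `k` distinct complex numbers with
`z ^ n = (-1) ^ (k-1)` for all `z ∈ S`. -/
theorem cyclic_shift_fixed_iff (k n : ℕ) (hk : 1 ≤ k) (hkn : k ≤ n)
    (V : Submodule ℂ (Fin n → ℂ)) (hV : Module.finrank ℂ V = k) :
    Submodule.map (cycShift k n 1) V = V ↔
      ∃ S : Finset ℂ, S.card = k ∧ (∀ z ∈ S, z ^ n = (-1 : ℂ) ^ (k - 1)) ∧ V = VS n S := by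
  constructor
  · intro h
    obtain ⟨S, hS, hVS⟩ := eq_VS_of_cycShift_invariant k n (by omega) one_ne_zero
      (V := V) fun v hv => h.le (Submodule.mem_map_of_mem hv)
    refine ⟨S, ?_, fun z hz => by simpa using hS z hz, hVS⟩
    rw [← hV, hVS, finrank_VS k n (by omega) hS]
  · rintro ⟨S, -, hS, rfl⟩
    exact map_cycShift_VS k n (by simpa using hS) one_ne_zero (by omega)
end

section
/- Let 0 ≤ k ≤ n with n ≥ 1. The number of k-dimensional ℂ-linear subspaces V of ℂⁿ with σ(V) = V is exactly the binomial coefficient C(n,k). -/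
open scoped BigOperators

open Module

theorem Module.Basis.finrank_span_image {K E ι : Type*} [Field K] [AddCommGroup E] [Module K E]
    (b : Basis ι K E) (S : Finset ι) :
    finrank K (Submodule.span K (b '' (S : Set ι))) = S.card := by
  classical
  rw [← Finset.coe_image, finrank_span_finset_eq_card,
    Finset.card_image_of_injective _ b.injective]
  rw [Finset.coe_image]
  exact b.linearIndependent.linearIndepOn_id.mono (Set.image_subset_range _ _)

section Eigenbasis

variable {K E ι : Type*} [Field K] [AddCommGroup E] [Module K E]
  {f : End K E} {μ : ι → K} {b : Basis ι K E} {V : Submodule K E}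

theorem map_span_image_of_eigenvectors (hμ₀ : ∀ i, μ i ≠ 0) (hb : ∀ i, f (b i) = μ i • b i)
    (S : Set ι) : (Submodule.span K (b '' S)).map f = Submodule.span K (b '' S) := by
  refine le_antisymm ?_ ?_
  · rw [Submodule.map_span_le]
    rintro _ ⟨i, hi, rfl⟩
    rw [hb]
    exact Submodule.smul_mem _ _ (Submodule.subset_span ⟨i, hi, rfl⟩)
  · rw [Submodule.span_le]
    rintro _ ⟨i, hi, rfl⟩
    refine ⟨(μ i)⁻¹ • b i, Submodule.smul_mem _ _ (Submodule.subset_span ⟨i, hi, rfl⟩), ?_⟩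
    rw [map_smul, hb, inv_smul_smul₀ (hμ₀ i)]

variable [Fintype ι]

theorem repr_smul_mem_of_invariant (hμ : Function.Injective μ) (hb : ∀ i, f (b i) = μ i • b i)
    (hV : V ≤ V.comap f) {v : E} (hv : v ∈ V) (i : ι) : b.repr v i • b i ∈ V := by
  classical
  have h := Polynomial.aeval_apply_smul_mem_of_le_comap hv (Lagrange.basis Finset.univ μ i) f hV
  rw [← b.sum_repr v, map_sum, Finset.sum_eq_single i] at h
  · rwa [map_smul, End.aeval_apply_of_mem_apply_eq_smul (hb i),
      Lagrange.eval_basis_self hμ.injOn (Finset.mem_univ i), one_smul] at h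
  · intro j _ hj
    rw [map_smul, End.aeval_apply_of_mem_apply_eq_smul (hb j),
      Lagrange.eval_basis_of_ne hj.symm (Finset.mem_univ j), zero_smul, smul_zero]
  · exact fun hi => absurd (Finset.mem_univ i) hi

theorem span_image_basis_mem_eq_of_invariant (hμ : Function.Injective μ)
    (hb : ∀ i, f (b i) = μ i • b i) (hV : V ≤ V.comap f) :
    Submodule.span K (b '' {i | b i ∈ V}) = V := by
  refine le_antisymm (Submodule.span_le.2 (by rintro _ ⟨i, hi, rfl⟩; exact hi)) fun v hv => ?_
  refine b.mem_span_image.2 fun i hi => ?_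
  exact (V.smul_mem_iff (Finsupp.mem_support_iff.1 hi)).1
    (repr_smul_mem_of_invariant hμ hb hV hv i)

theorem ncard_finrank_eq_map_eq (hμ : Function.Injective μ) (hμ₀ : ∀ i, μ i ≠ 0)
    (hb : ∀ i, f (b i) = μ i • b i) (k : ℕ) :
    {V : Submodule K E | finrank K V = k ∧ V.map f = V}.ncard = (Fintype.card ι).choose k := by
  classical
  have himage : {V : Submodule K E | finrank K V = k ∧ V.map f = V} =
      (fun S : Finset ι => Submodule.span K (b '' (S : Set ι))) ''
        (Finset.univ.powersetCard k : Finset (Finset ι)) := by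
    ext V
    simp only [Set.mem_ofPred_eq, Set.mem_image, Finset.mem_coe, Finset.mem_powersetCard_univ]
    constructor
    · rintro ⟨rfl, hV⟩
      have hS := span_image_basis_mem_eq_of_invariant hμ hb (Submodule.map_le_iff_le_comap.1 hV.le)
      have hfilter : ((Finset.univ.filter fun i => b i ∈ V : Finset ι) : Set ι) =
          {i | b i ∈ V} := by
        ext i
        simp
      refine ⟨Finset.univ.filter fun i => b i ∈ V, ?_, by rwa [hfilter]⟩
      rw [← b.finrank_span_image, hfilter, hS]
    · rintro ⟨S, rfl, rfl⟩
      exact ⟨b.finrank_span_image S, map_span_image_of_eigenvectors hμ₀ hb S⟩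
  rw [himage, Set.ncard_image_of_injective, Set.ncard_coe_finset, Finset.card_powersetCard,
    Finset.card_univ]
  intro S T hST
  ext i
  simpa only [b.self_mem_span_image, Finset.mem_coe] using
    (iff_of_eq (congrArg (b i ∈ ·) hST) : b i ∈ Submodule.span K (b '' (S : Set ι)) ↔ _)

end Eigenbasis

theorem cycShift_geometric {k n : ℕ} {t z : ℂ} (hz : z ^ n = (-1) ^ (k - 1) * t) :
    cycShift k n t (fun j => z ^ (j : ℕ)) = z • fun j : Fin n => z ^ (j : ℕ) := by
  funext i
  by_cases h : (i : ℕ) + 1 < n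
  · simp [cycShift, h, pow_succ']
  · have hi : (i : ℕ) + 1 = n := by omega
    simp [cycShift, ← hz, ← pow_succ', hi]

theorem exists_injective_pow_eq {n : ℕ} (hn : n ≠ 0) {c : ℂ} (hc : c ≠ 0) :
    ∃ z : Fin n → ℂ, Function.Injective z ∧ ∀ i, z i ^ n = c := by
  obtain ⟨w, rfl⟩ := IsAlgClosed.exists_pow_nat_eq c (Nat.pos_of_ne_zero hn)
  have hw : w ≠ 0 := by rintro rfl; exact hc (zero_pow hn)
  have hζ := Complex.isPrimitiveRoot_exp n hn
  refine ⟨fun i => Complex.exp (2 * Real.pi * Complex.I / n) ^ (i : ℕ) * w, fun i j hij => ?_,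
    fun i => ?_⟩
  · exact Fin.ext (hζ.pow_inj i.2 j.2 (mul_right_cancel₀ hw hij))
  · rw [mul_pow, ← pow_mul, mul_comm, mul_comm (i : ℕ), pow_mul, hζ.pow_eq_one, one_pow, mul_one]

/-- For `0 ≤ k ≤ n` with `n ≥ 1`, the number of `k`-dimensional
subspaces `V ⊆ ℂⁿ` with `σ(V) = V` is exactly `C(n,k)`. -/
theorem card_cyclic_shift_fixed (k n : ℕ) (hkn : k ≤ n) (hn : 1 ≤ n) :
    {V : Submodule ℂ (Fin n → ℂ) |
        Module.finrank ℂ V = k ∧ Submodule.map (cycShift k n 1) V = V}.ncard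
      = Nat.choose n k := by
  have hc : (-1 : ℂ) ^ (k - 1) * 1 ≠ 0 := by simp
  obtain ⟨z, hinj, hz⟩ := exists_injective_pow_eq (by omega : n ≠ 0) hc
  have hli : LinearIndependent ℂ (Matrix.vandermonde z).row :=
    Matrix.linearIndependent_rows_of_det_ne_zero (Matrix.det_vandermonde_ne_zero_iff.2 hinj)
  have : Nonempty (Fin n) := ⟨⟨0, hn⟩⟩
  let b := basisOfLinearIndependentOfCardEqFinrank hli (by simp)
  have hb : ∀ i, cycShift k n 1 (b i) = z i • b i := fun i => by
    rw [coe_basisOfLinearIndependentOfCardEqFinrank]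
    exact cycShift_geometric (hz i)
  have hz₀ : ∀ i, z i ≠ 0 := fun i h => hc (by rw [← hz i, h, zero_pow (by omega)])
  rw [ncard_finrank_eq_map_eq hinj hz₀ hb, Fintype.card_fin]
end

section
/- (Gantmakher–Krein) Let 1 ≤ k ≤ n and let V be a k-dimensional subspace of ℝⁿ. Then the following are equivalent: (i) there exists a real k×n matrix A whose rows form a basis of V such that every k×k minor of A, taken with columns in increasing order, is ≥ 0; (ii) every vector v ∈ V changes sign at most k−1 times. -/
open scoped BigOperators

/-- `v ∈ ℝⁿ` changes sign at most `m` times: there are no indices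
`i₀ < i₁ < ⋯ < i_{m+1}` with `v_{i_j} · v_{i_{j+1}} < 0` for all `0 ≤ j ≤ m`. -/
def SignChangesAtMost (n m : ℕ) (v : Fin n → ℝ) : Prop :=
  ¬ ∃ g : Fin (m + 2) → Fin n, StrictMono g ∧
      ∀ j : Fin (m + 1), v (g j.castSucc) * v (g j.succ) < 0

/-- A real version of total nonnegativity for a subspace `V ⊆ ℝⁿ`. -/
def IsTotallyNonnegR (k n : ℕ) (V : Submodule ℝ (Fin n → ℝ)) : Prop :=
  ∃ A : Matrix (Fin k) (Fin n) ℝ,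
    LinearIndependent ℝ (fun p : Fin k => A p) ∧
    Submodule.span ℝ (Set.range fun p : Fin k => A p) = V ∧
    ∀ g : Fin k → Fin n, StrictMono g → 0 ≤ (A.submatrix id g).det

open Matrix in
/-- Laplace expansion of a `k × (k + 1)` matrix bordered on top by a row `u`. -/
lemma det_cons_row {k : ℕ} (M : Matrix (Fin k) (Fin (k + 1)) ℝ) (u : Fin (k + 1) → ℝ) :
    (Matrix.of (Fin.cons u M : Fin (k + 1) → Fin (k + 1) → ℝ)).det =
      ∑ j : Fin (k + 1), (-1) ^ (j : ℕ) * u j * (M.submatrix id j.succAbove).det := by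
  rw [Matrix.det_succ_row_zero]
  rfl

open Matrix in
lemma cons_vecMul_cons {k l : ℕ} (M : Matrix (Fin k) (Fin l) ℝ) (u : Fin l → ℝ)
    (w : Fin (k + 1) → ℝ) :
    w ᵥ* (Matrix.of (Fin.cons u M : Fin (k + 1) → Fin l → ℝ)) =
      w 0 • u + (fun p => w p.succ) ᵥ* M := by
  ext j
  simp only [Matrix.vecMul, dotProduct, Fin.sum_univ_succ, Matrix.of_apply, Pi.add_apply,
    Pi.smul_apply, smul_eq_mul]
  rfl

open Matrix in
/-- A vector in the row space of a `k × (k + 1)` matrix satisfies the linear relation whose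
coefficients are the signed maximal minors. -/
lemma sum_minors_eq_zero {k : ℕ} (M : Matrix (Fin k) (Fin (k + 1)) ℝ) (c : Fin k → ℝ) :
    ∑ j : Fin (k + 1), (-1) ^ (j : ℕ) * (c ᵥ* M) j * (M.submatrix id j.succAbove).det = 0 := by
  rw [← det_cons_row, ← Matrix.exists_vecMul_eq_zero_iff]
  refine ⟨Fin.cons (-1) c, fun h => ?_, ?_⟩
  · simpa using congrFun h 0
  · rw [cons_vecMul_cons]
    simp

open Matrix in
/-- Conversely, if some maximal minor is nonzero, then the relation cuts out the row space. -/
lemma exists_vecMul_eq_of_sum_minors {k : ℕ} (M : Matrix (Fin k) (Fin (k + 1)) ℝ)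
    (u : Fin (k + 1) → ℝ) (i : Fin (k + 1)) (hi : (M.submatrix id i.succAbove).det ≠ 0)
    (hu : ∑ j : Fin (k + 1), (-1) ^ (j : ℕ) * u j * (M.submatrix id j.succAbove).det = 0) :
    ∃ c : Fin k → ℝ, c ᵥ* M = u := by
  rw [← det_cons_row, ← Matrix.exists_vecMul_eq_zero_iff] at hu
  obtain ⟨w, hw, h⟩ := hu
  rw [cons_vecMul_cons] at h
  by_cases h0 : w 0 = 0
  · exfalso
    apply hi
    rw [← Matrix.exists_vecMul_eq_zero_iff]
    refine ⟨fun p => w p.succ, fun h' => hw ?_, ?_⟩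
    · ext p
      refine Fin.cases h0 (fun q => congrFun h' q) p
    · ext j
      have := congrFun h (i.succAbove j)
      simpa [h0, Matrix.vecMul, dotProduct] using this
  · refine ⟨fun p => -(w 0)⁻¹ * w p.succ, ?_⟩
    ext j
    have := congrFun h j
    have e : ((fun p => -(w 0)⁻¹ * w p.succ) ᵥ* M) j
        = -(w 0)⁻¹ * ((fun p => w p.succ) ᵥ* M) j := by
      simp [Matrix.vecMul, dotProduct, Finset.mul_sum, mul_assoc]
    simp only [Pi.add_apply, Pi.smul_apply, smul_eq_mul, Pi.zero_apply] at this
    rw [e]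
    field_simp
    linarith

/-- In a strictly alternating sequence, `(-1) ^ j * x j` has the sign of `x 0`. -/
lemma alternating_sign {m : ℕ} (x : Fin (m + 2) → ℝ)
    (hx : ∀ j : Fin (m + 1), x j.castSucc * x j.succ < 0) (j : Fin (m + 2)) :
    0 < x 0 * ((-1) ^ (j : ℕ) * x j) := by
  induction j using Fin.induction with
  | zero =>
    have := hx 0
    have h0 : x 0 ≠ 0 := by
      rintro h
      simp [h] at this
    simpa using mul_self_pos.2 h0
  | succ i ih =>
    have := hx i
    simp only [Fin.val_succ, Fin.val_castSucc, pow_succ] at ih ⊢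
    have h1 : 0 < (x 0 * ((-1) ^ (i : ℕ) * x i.castSucc)) * -(x i.castSucc * x i.succ) :=
      mul_pos ih (by linarith)
    have h2 : 0 < (x i.castSucc) ^ 2 := by
      have : x i.castSucc ≠ 0 := by
        rintro h
        simp [h] at this
      positivity
    nlinarith

/-- Moving one value of a strictly increasing map to a free neighbouring spot keeps the map
strictly increasing. -/
lemma StrictMono.update_adjacent {k n : ℕ} {f : Fin k → Fin n} (hf : StrictMono f) (p : Fin k)
    (b : Fin n) (hb : (b : ℕ) = f p + 1 ∨ (f p : ℕ) = b + 1) (hfree : ∀ q, f q ≠ b) :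
    StrictMono (Function.update f p b) := by
  intro i j hij
  have h := hf hij
  have hi := hfree i
  have hj := hfree j
  simp only [Function.update_apply]
  rw [Fin.lt_def] at h ⊢
  rw [Ne, Fin.ext_iff] at hi hj
  split_ifs with h1 h2 h2
  · omega
  · subst h1; omega
  · subst h2; omega
  · omega

/-- A strictly increasing map can be moved towards another one by a single adjacent move. -/
lemma StrictMono.exists_adjacent_move {k n : ℕ} {f g : Fin k → Fin n} (hf : StrictMono f)
    (hg : StrictMono g) (hfg : f ≠ g) :
    ∃ (p : Fin k) (b : Fin n), ((b : ℕ) = f p + 1 ∨ (f p : ℕ) = b + 1) ∧ (∀ q, f q ≠ b) ∧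
      ((b : ℤ) - g p).natAbs < ((f p : ℤ) - g p).natAbs := by
  by_cases h : ∃ p, f p < g p
  · obtain ⟨p, hp, hmax⟩ := (Set.toFinite {p | f p < g p}).exists_maximal h
    have hp' : f p < g p := hp
    rw [Fin.lt_def] at hp'
    refine ⟨p, ⟨f p + 1, by omega⟩, Or.inl rfl, fun q hq => ?_, ?_⟩
    · have hq' : (f q : ℕ) = f p + 1 := by rw [hq]
      have hpq : p < q := by
        rw [← hf.lt_iff_lt, Fin.lt_def]
        omega
      have h2 := hg hpq
      rw [Fin.lt_def] at h2
      have : f q < g q := by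
        rw [Fin.lt_def]
        omega
      exact absurd (hmax this hpq.le) (not_le.2 hpq)
    · simp only
      omega
  · push Not at h
    have h' : ∃ p, g p < f p := by
      by_contra hc
      push Not at hc
      exact hfg (funext fun p => le_antisymm (hc p) (h p))
    obtain ⟨p, hp, hmin⟩ := (Set.toFinite {p | g p < f p}).exists_minimal h'
    have hp' : g p < f p := hp
    rw [Fin.lt_def] at hp'
    refine ⟨p, ⟨f p - 1, by omega⟩, Or.inr (by simp only; omega), fun q hq => ?_, ?_⟩
    · have hq' : (f q : ℕ) = f p - 1 := by rw [hq]
      have hpq : q < p := by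
        rw [← hf.lt_iff_lt, Fin.lt_def]
        omega
      have h2 := hg hpq
      rw [Fin.lt_def] at h2
      have : g q < f q := by
        rw [Fin.lt_def]
        omega
      exact absurd (hmin this hpq.le) (not_le.2 hpq)
    · simp only
      omega

open Matrix in
/-- Effect on a minor of adding a multiple of column `a` to column `b`. -/
lemma det_submatrix_updateCol {k n : ℕ} (A : Matrix (Fin k) (Fin n) ℝ) (a b : Fin n) (ε : ℝ)
    (g : Fin k → Fin n) (hg : Function.Injective g) (q : Fin k) (hq : g q = b) :
    ((A.updateCol b (fun i => A i b + ε * A i a)).submatrix id g).det =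
      (A.submatrix id g).det + ε * (A.submatrix id (Function.update g q a)).det := by
  have e : (A.updateCol b (fun i => A i b + ε * A i a)).submatrix id g =
      (A.submatrix id g).updateCol q ((fun i => A i b) + ε • fun i => A i a) := by
    ext i j
    by_cases hj : j = q
    · subst hj
      simp [hq]
    · have : g j ≠ b := fun h => hj (hg (h.trans hq.symm))
      simp [hj, this]
  rw [e, Matrix.det_updateCol_add, Matrix.det_updateCol_smul]
  congr 2
  · ext i j
    by_cases hj : j = q
    · subst hj
      simp [hq]
    · simp [hj]
  · congr 1
    ext i j
    by_cases hj : j = q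
    · subst hj
      simp
    · simp [hj]

/-- Adding a nonnegative multiple of a column to a neighbouring one preserves nonnegativity of
the maximal minors. -/
lemma minors_nonneg_updateCol {k n : ℕ} (A : Matrix (Fin k) (Fin n) ℝ)
    (hA : ∀ g : Fin k → Fin n, StrictMono g → 0 ≤ (A.submatrix id g).det) (a b : Fin n)
    (hab : (b : ℕ) = a + 1 ∨ (a : ℕ) = b + 1) (ε : ℝ) (hε : 0 ≤ ε)
    (g : Fin k → Fin n) (hg : StrictMono g) :
    0 ≤ ((A.updateCol b (fun i => A i b + ε * A i a)).submatrix id g).det := by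
  by_cases h : ∃ q, g q = b
  · obtain ⟨q, hq⟩ := h
    rw [det_submatrix_updateCol A a b ε g hg.injective q hq]
    refine add_nonneg (hA g hg) (mul_nonneg hε ?_)
    by_cases h' : ∃ r, g r = a
    · obtain ⟨r, hr⟩ := h'
      have hrq : r ≠ q := by
        rintro rfl
        rw [hr] at hq
        subst hq
        omega
      refine (Matrix.det_zero_of_column_eq hrq fun i => ?_).ge
      simp [hrq, hr]
    · push Not at h'
      exact hA _ (hg.update_adjacent q a (by rw [hq]; exact hab.symm) h')
  · push Not at h
    have e : (A.updateCol b (fun i => A i b + ε * A i a)).submatrix id g = A.submatrix id g := by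
      ext i j
      simp [h j]
    rw [e]
    exact hA g hg

open Matrix Filter Topology in
/-- If all maximal minors are nonnegative and one of them is positive, then no vector of the row
space has too many sign changes. The proof moves the positive minor, one adjacent step at a time,
to the columns where the vector alternates. -/
lemma not_alternating_of_minors_nonneg {m n : ℕ} (A : Matrix (Fin (m + 1)) (Fin n) ℝ)
    (hA : ∀ g : Fin (m + 1) → Fin n, StrictMono g → 0 ≤ (A.submatrix id g).det)
    (c : Fin (m + 1) → ℝ) (g : Fin (m + 2) → Fin n) (hg : StrictMono g)
    (hv : ∀ j : Fin (m + 1), (c ᵥ* A) (g j.castSucc) * (c ᵥ* A) (g j.succ) < 0)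
    (f : Fin (m + 1) → Fin n) (hf : StrictMono f) (hpos : 0 < (A.submatrix id f).det) :
    False := by
  induction hN : ∑ p, ((f p : ℤ) - g p.castSucc).natAbs using Nat.strong_induction_on
    generalizing A f with
  | _ N ih =>
  have hg' : StrictMono fun p : Fin (m + 1) => g p.castSucc :=
    hg.comp (Fin.strictMono_castSucc)
  by_cases hfg : f = fun p => g p.castSucc
  · have hsum := sum_minors_eq_zero (A.submatrix id g) c
    have hs := alternating_sign (fun j => (c ᵥ* A) (g j)) hv
    have hmul : ∑ j : Fin (m + 2), (c ᵥ* A) (g 0) * ((-1) ^ (j : ℕ) * (c ᵥ* A) (g j)) *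
        (A.submatrix id (g ∘ j.succAbove)).det = 0 := by
      have := congrArg (fun x => (c ᵥ* A) (g 0) * x) hsum
      simp only [Finset.mul_sum, mul_zero] at this
      rw [← this]
      refine Finset.sum_congr rfl fun j _ => ?_
      rw [Matrix.submatrix_submatrix, mul_assoc]
      rfl
    have hnn : ∀ j ∈ (Finset.univ : Finset (Fin (m + 2))),
        0 ≤ (c ᵥ* A) (g 0) * ((-1) ^ (j : ℕ) * (c ᵥ* A) (g j)) *
          (A.submatrix id (g ∘ j.succAbove)).det := fun j _ =>
      mul_nonneg (hs j).le (hA _ (hg.comp (Fin.strictMono_succAbove j)))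
    have hlast := (Finset.sum_eq_zero_iff_of_nonneg hnn).1 hmul (Fin.last _) (Finset.mem_univ _)
    have e : g ∘ (Fin.last (m + 1)).succAbove = f := by
      rw [hfg]
      ext p
      simp
    rw [e] at hlast
    exact (mul_pos (hs _) hpos).ne' hlast
  · obtain ⟨p, b, hadj, hfree, hlt⟩ := hf.exists_adjacent_move hg' hfg
    have hentry : ∀ (ε : ℝ) (x : Fin n),
        (c ᵥ* A.updateCol b (fun i => A i b + ε * A i (f p))) x =
          if x = b then (c ᵥ* A) b + ε * (c ᵥ* A) (f p) else (c ᵥ* A) x := by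
      intro ε x
      split_ifs with hx
      · subst hx
        simp only [Matrix.vecMul, dotProduct, Matrix.updateCol_self, Finset.mul_sum]
        rw [← Finset.sum_add_distrib]
        exact Finset.sum_congr rfl fun i _ => by ring
      · simp [Matrix.vecMul, dotProduct, hx]
    have hcont : ∀ x : Fin n, Continuous fun ε : ℝ =>
        (c ᵥ* A.updateCol b (fun i => A i b + ε * A i (f p))) x := by
      intro x
      simp only [hentry]
      split_ifs <;> fun_prop
    have hev : ∀ᶠ ε : ℝ in 𝓝[>] 0, ∀ j : Fin (m + 1),
        (c ᵥ* A.updateCol b (fun i => A i b + ε * A i (f p))) (g j.castSucc) *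
          (c ᵥ* A.updateCol b (fun i => A i b + ε * A i (f p))) (g j.succ) < 0 := by
      rw [eventually_all]
      intro j
      refine Filter.Eventually.filter_mono nhdsWithin_le_nhds ?_
      refine ((hcont _).mul (hcont _)).continuousAt.eventually_lt continuousAt_const ?_
      have h0 : ∀ x : Fin n,
          (c ᵥ* A.updateCol b (fun i => A i b + 0 * A i (f p))) x = (c ᵥ* A) x := by
        intro x
        rw [hentry]
        split_ifs with hx
        · rw [hx, zero_mul, add_zero]
        · rfl
      change (c ᵥ* A.updateCol b (fun i => A i b + 0 * A i (f p))) (g j.castSucc) *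
        (c ᵥ* A.updateCol b (fun i => A i b + 0 * A i (f p))) (g j.succ) < 0
      rw [h0, h0]
      exact hv j
    obtain ⟨ε, hε, hε0⟩ := (hev.and self_mem_nhdsWithin).exists
    have hε0 : 0 < ε := hε0
    have hf' := hf.update_adjacent p b hadj hfree
    refine ih _ ?_ (A.updateCol b (fun i => A i b + ε * A i (f p)))
      (minors_nonneg_updateCol A hA _ _ hadj ε hε0.le) hε (Function.update f p b) hf' ?_ rfl
    · rw [← hN]
      refine Finset.sum_lt_sum (fun q _ => ?_) ⟨p, Finset.mem_univ _, by simpa using hlt⟩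
      by_cases hq : q = p
      · subst hq
        simpa using hlt.le
      · simp [hq]
    · rw [det_submatrix_updateCol A (f p) b ε _ hf'.injective p (by simp)]
      have e : Function.update (Function.update f p b) p (f p) = f := by simp
      rw [e]
      exact add_pos_of_nonneg_of_pos (hA _ hf') (mul_pos hε0 hpos)

lemma det_submatrix_ne_zero_iff {k n : ℕ} (A : Matrix (Fin k) (Fin n) ℝ) (f : Fin k → Fin n)
    (hf : Function.Injective f) :
    (A.submatrix id f).det ≠ 0 ↔ LinearIndepOn ℝ (fun j => A.col j) (Set.range f) := by
  rw [linearIndepOn_range_iff hf, ← isUnit_iff_ne_zero, ← Matrix.isUnit_iff_isUnit_det,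
    ← Matrix.linearIndependent_cols_iff_isUnit]
  rfl

lemma exists_strictMono_range_eq {k n : ℕ} (s : Set (Fin n)) (hs : s.ncard = k) :
    ∃ f : Fin k → Fin n, StrictMono f ∧ Set.range f = s := by
  classical
  have hs' : s.toFinset.card = k := by rw [← Set.ncard_eq_toFinset_card', hs]
  exact ⟨s.toFinset.orderEmbOfFin hs', (s.toFinset.orderEmbOfFin hs').strictMono, by simp⟩

/-- A matrix with linearly independent rows has a nonzero maximal minor. -/
lemma exists_minor_ne_zero {k n : ℕ} (A : Matrix (Fin k) (Fin n) ℝ)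
    (hA : LinearIndependent ℝ (fun p : Fin k => A p)) :
    ∃ f : Fin k → Fin n, StrictMono f ∧ (A.submatrix id f).det ≠ 0 := by
  have hspan : Module.finrank ℝ (Submodule.span ℝ (Set.range A.col)) = k := by
    rw [← Matrix.rank_eq_finrank_span_cols]
    simpa using LinearIndependent.rank_matrix hA
  obtain ⟨s, -, -, hs, hsi⟩ := exists_linearIndepOn_extension (K := ℝ) (v := A.col)
    (linearIndepOn_empty _ _) (Set.empty_subset Set.univ)
  have hspan' : Submodule.span ℝ (A.col '' s) = Submodule.span ℝ (Set.range A.col) := by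
    refine le_antisymm (Submodule.span_mono (Set.image_subset_range _ _)) ?_
    rw [Submodule.span_le, ← Set.image_univ]
    exact hs
  have : Fintype s := Fintype.ofFinite s
  have hcard : s.ncard = k := by
    rw [← hspan, ← hspan', Set.image_eq_range, finrank_span_eq_card hsi, ← Nat.card_eq_fintype_card,
      Nat.card_coe_set_eq]
  obtain ⟨f, hf, rfl⟩ := exists_strictMono_range_eq s hcard
  exact ⟨f, hf, (det_submatrix_ne_zero_iff A f hf.injective).2 hsi⟩

/-- If no vector in the row space alternates too often, then the maximal minors of any `k + 1`
columns do not take both signs. -/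
lemma minors_not_opposite {m n : ℕ} (A : Matrix (Fin (m + 1)) (Fin n) ℝ)
    (hA : ∀ c : Fin (m + 1) → ℝ, SignChangesAtMost n m (Matrix.vecMul c A))
    (h : Fin (m + 2) → Fin n) (hh : StrictMono h) (i j : Fin (m + 2))
    (hi : 0 < (A.submatrix id (h ∘ i.succAbove)).det)
    (hj : (A.submatrix id (h ∘ j.succAbove)).det < 0) : False := by
  have hij : i ≠ j := by
    rintro rfl
    exact lt_asymm hi hj
  set M : Fin (m + 2) → ℝ := fun l => (A.submatrix id (h ∘ l.succAbove)).det with hM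
  obtain ⟨t, ht, hsum⟩ : ∃ t : Fin (m + 2) → ℝ, (∀ l, 0 < t l) ∧ ∑ l, t l * M l = 0 := by
    rcases le_total 0 (∑ l, M l) with hs | hs
    · refine ⟨fun l => 1 + if l = j then (∑ l, M l) / -M j else 0, fun l => ?_, ?_⟩
      · have : 0 ≤ (∑ l, M l) / -M j := div_nonneg hs (by linarith)
        simp only
        split_ifs <;> linarith
      · simp only [add_mul, Finset.sum_add_distrib, one_mul, ite_mul, zero_mul,
          Finset.sum_ite_eq', Finset.mem_univ, if_true]
        have : M j ≠ 0 := hj.ne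
        field_simp
        ring
    · refine ⟨fun l => 1 + if l = i then -(∑ l, M l) / M i else 0, fun l => ?_, ?_⟩
      · have : 0 ≤ -(∑ l, M l) / M i := div_nonneg (by linarith) hi.le
        simp only
        split_ifs <;> linarith
      · simp only [add_mul, Finset.sum_add_distrib, one_mul, ite_mul, zero_mul,
          Finset.sum_ite_eq', Finset.mem_univ, if_true]
        have : M i ≠ 0 := hi.ne'
        field_simp
        ring
  obtain ⟨c, hc⟩ := exists_vecMul_eq_of_sum_minors (A.submatrix id h)
    (fun l => (-1) ^ (l : ℕ) * t l) i (by rw [Matrix.submatrix_submatrix]; exact hi.ne') (by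
      rw [← hsum]
      refine Finset.sum_congr rfl fun l _ => ?_
      rw [← mul_assoc, ← mul_pow, Matrix.submatrix_submatrix]
      simp [hM])
  refine hA c ⟨h, hh, fun l => ?_⟩
  have hval : ∀ l, Matrix.vecMul c A (h l) = (-1) ^ (l : ℕ) * t l := fun l => congrFun hc l
  rw [hval, hval, Fin.val_succ, Fin.val_castSucc, pow_succ]
  have h1 : ((-1 : ℝ) ^ (l : ℕ)) * (-1) ^ (l : ℕ) = 1 := by
    rw [← mul_pow]
    simp
  have h2 := mul_pos (ht l.castSucc) (ht l.succ)
  linear_combination h2 - (t l.castSucc * t l.succ) * h1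

/-- A strictly increasing map omitting one element of a set of `k + 1` columns is obtained from the
enumeration of that set by skipping an index. -/
lemma exists_comp_succAbove_eq {k n : ℕ} (h : Fin (k + 1) → Fin n) (hh : StrictMono h)
    (f : Fin k → Fin n) (hf : StrictMono f) (hfh : Set.range f ⊆ Set.range h) :
    ∃ i : Fin (k + 1), h ∘ i.succAbove = f := by
  choose e he using fun p => hfh ⟨p, rfl⟩
  have hemono : StrictMono e := fun p q hpq => by
    rw [← hh.lt_iff_lt, he, he]
    exact hf hpq
  obtain ⟨i, hi⟩ : ∃ i, i ∉ Set.range e := by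
    by_contra hc
    push Not at hc
    have := Fintype.card_le_of_surjective e hc
    simp at this
  refine ⟨i, ?_⟩
  have hr : Set.range i.succAbove = Set.range e := by
    rw [Fin.range_succAbove]
    refine (Set.eq_of_subset_of_ncard_le (fun x hx => ?_) ?_ (Set.toFinite _)).symm
    · rintro rfl
      exact hi hx
    · rw [Set.ncard_compl, Set.ncard_range_of_injective hemono.injective]
      simp
  have := (Fin.strictMono_succAbove i).range_inj hemono |>.1 hr
  rw [this]
  exact funext he

/-- Basis exchange for nonzero maximal minors. -/
lemma exists_minor_exchange {k n : ℕ} (A : Matrix (Fin k) (Fin n) ℝ) (f g : Fin k → Fin n)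
    (hf : StrictMono f) (hg : StrictMono g) (hf0 : (A.submatrix id f).det ≠ 0)
    (hg0 : (A.submatrix id g).det ≠ 0) (hfg : f ≠ g) :
    ∃ f' : Fin k → Fin n, StrictMono f' ∧ (A.submatrix id f').det ≠ 0 ∧
      (∃ b ∉ Set.range f, Set.range f' ⊆ insert b (Set.range f)) ∧
      (Set.range f' \ Set.range g).ncard < (Set.range f \ Set.range g).ncard := by
  have hfi := (det_submatrix_ne_zero_iff A f hf.injective).1 hf0
  have hgi := (det_submatrix_ne_zero_iff A g hg.injective).1 hg0
  have hnsub : ¬ Set.range f ⊆ Set.range g := by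
    intro hsub
    refine hfg (hf.range_inj hg |>.1 (Set.eq_of_subset_of_ncard_le hsub ?_ (Set.toFinite _)))
    rw [Set.ncard_range_of_injective hf.injective, Set.ncard_range_of_injective hg.injective]
  obtain ⟨a, ha, hag⟩ := Set.not_subset.1 hnsub
  have hins : insert a (Set.range f \ {a}) = Set.range f := Set.insert_sdiff_self_of_mem ha
  obtain ⟨hRi, hRa⟩ := (linearIndepOn_insert (f := fun j => A.col j)
    (show a ∉ Set.range f \ {a} by simp)).1 (hins.symm ▸ hfi)
  obtain ⟨b, hbg, hbR⟩ : ∃ b ∈ Set.range g,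
      A.col b ∉ Submodule.span ℝ (A.col '' (Set.range f \ {a})) := by
    by_contra! hc
    apply hRa
    have htop : Submodule.span ℝ (A.col '' Set.range g) = ⊤ := by
      rw [← Set.range_comp]
      refine LinearIndependent.span_eq_top_of_card_eq_finrank'
        ((linearIndepOn_range_iff hg.injective _).1 hgi) (by simp)
    have : Submodule.span ℝ (A.col '' Set.range g) ≤
        Submodule.span ℝ (A.col '' (Set.range f \ {a})) := by
      rw [Submodule.span_le]
      rintro _ ⟨b, hb, rfl⟩
      exact hc b hb
    rw [htop] at this
    exact this trivial
  have hba : b ≠ a := by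
    rintro rfl
    exact hag hbg
  have hbnR : b ∉ Set.range f \ {a} := fun hb => hbR (Submodule.subset_span ⟨b, hb, rfl⟩)
  have hbf : b ∉ Set.range f := fun hb => hbnR ⟨hb, hba⟩
  have hTi := (linearIndepOn_insert (f := fun j => A.col j) hbnR).2 ⟨hRi, hbR⟩
  obtain ⟨f', hf', hr⟩ := exists_strictMono_range_eq (k := k) (insert b (Set.range f \ {a})) (by
    rw [Set.ncard_exchange hbf ha, Set.ncard_range_of_injective hf.injective]
    simp)
  refine ⟨f', hf', (det_submatrix_ne_zero_iff A f' hf'.injective).2 (hr ▸ hTi),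
    ⟨b, hbf, ?_⟩, ?_⟩
  · rw [hr]
    exact Set.insert_subset_insert Set.sdiff_subset
  · refine Set.ncard_lt_ncard ⟨?_, fun hc => ?_⟩ (Set.toFinite _)
    · rw [hr]
      rintro x ⟨rfl | hx, hxg⟩
      · exact absurd hbg hxg
      · exact ⟨hx.1, hxg⟩
    · have := (hc ⟨ha, hag⟩).1
      rw [hr] at this
      rcases this with h | h
      · exact hba h.symm
      · exact h.2 rfl

/-- If no vector in the row space alternates too often, then all nonzero maximal minors have the
same sign. -/
lemma minors_mul_pos {m n : ℕ} (A : Matrix (Fin (m + 1)) (Fin n) ℝ)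
    (hA : ∀ c : Fin (m + 1) → ℝ, SignChangesAtMost n m (Matrix.vecMul c A))
    (f g : Fin (m + 1) → Fin n) (hf : StrictMono f) (hg : StrictMono g)
    (hf0 : (A.submatrix id f).det ≠ 0) (hg0 : (A.submatrix id g).det ≠ 0) :
    0 < (A.submatrix id f).det * (A.submatrix id g).det := by
  induction hN : (Set.range f \ Set.range g).ncard using Nat.strong_induction_on
    generalizing f with
  | _ N ih =>
  by_cases hfg : f = g
  · subst hfg
    exact mul_self_pos.2 hf0
  obtain ⟨f', hf', hfz, ⟨b, hb, hsub⟩, hlt⟩ := exists_minor_exchange A f g hf hg hf0 hg0 hfg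
  have h1 := ih _ (hN ▸ hlt) f' hf' hfz rfl
  have hcard : (insert b (Finset.univ.image f)).card = m + 2 := by
    rw [Finset.card_insert_of_notMem (by simpa using hb),
      Finset.card_image_of_injective _ hf.injective]
    simp
  have hh := ((insert b (Finset.univ.image f)).orderEmbOfFin hcard).strictMono
  have hrange : Set.range ((insert b (Finset.univ.image f)).orderEmbOfFin hcard) =
      insert b (Set.range f) := by
    rw [Finset.range_orderEmbOfFin]
    simp
  obtain ⟨i, hi⟩ := exists_comp_succAbove_eq _ hh f hf (by rw [hrange]; exact Set.subset_insert _ _)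
  obtain ⟨j, hj⟩ := exists_comp_succAbove_eq _ hh f' hf' (by rw [hrange]; exact hsub)
  have key := minors_not_opposite A hA _ hh
  rcases lt_or_gt_of_ne hf0 with h2 | h2 <;> rcases lt_or_gt_of_ne hfz with h3 | h3
  · nlinarith
  · exact (key j i (by rwa [hj]) (by rwa [hi])).elim
  · exact (key i j (by rwa [hi]) (by rwa [hj])).elim
  · nlinarith

/-- The vectors of a basis of `V`, as rows of a matrix. -/
lemma basis_rows {k n : ℕ} {V : Submodule ℝ (Fin n → ℝ)} (b : Module.Basis (Fin k) ℝ V) :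
    LinearIndependent ℝ (fun p => (b p : Fin n → ℝ)) ∧
      Submodule.span ℝ (Set.range fun p => (b p : Fin n → ℝ)) = V := by
  refine ⟨b.linearIndependent.map' V.subtype V.ker_subtype, ?_⟩
  have : (Set.range fun p => (b p : Fin n → ℝ)) = V.subtype '' Set.range b := by
    rw [← Set.range_comp]
    rfl
  rw [this, Submodule.span_image, b.span_eq, Submodule.map_top, Submodule.range_subtype]

lemma mem_span_rows_iff {k n : ℕ} (A : Matrix (Fin k) (Fin n) ℝ) (v : Fin n → ℝ) :
    v ∈ Submodule.span ℝ (Set.range fun p : Fin k => A p) ↔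
      ∃ c : Fin k → ℝ, Matrix.vecMul c A = v := by
  rw [Submodule.mem_span_range_iff_exists_fun]
  simp only [Matrix.vecMul_eq_sum]

/-- Gantmakher–Krein: a `k`-dimensional subspace `V ⊆ ℝⁿ` is totally
nonnegative iff every vector of `V` changes sign at most `k − 1` times. -/
theorem gantmakher_krein (k n : ℕ) (hk : 1 ≤ k) (hkn : k ≤ n)
    (V : Submodule ℝ (Fin n → ℝ)) (hV : Module.finrank ℝ V = k) :
    IsTotallyNonnegR k n V ↔ ∀ v ∈ V, SignChangesAtMost n (k - 1) v := by
  obtain ⟨m, rfl⟩ : ∃ m, k = m + 1 := ⟨k - 1, by omega⟩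
  rw [Nat.add_sub_cancel]
  constructor
  · rintro ⟨A, hli, hspan, hA⟩ v hv ⟨g, hg, halt⟩
    rw [← hspan, mem_span_rows_iff] at hv
    obtain ⟨c, rfl⟩ := hv
    obtain ⟨f, hf, hf0⟩ := exists_minor_ne_zero A hli
    exact not_alternating_of_minors_nonneg A hA c g hg halt f hf ((hA f hf).lt_of_ne' hf0)
  · intro h
    let b : Module.Basis (Fin (m + 1)) ℝ V := Module.finBasisOfFinrankEq ℝ V hV
    let A : Matrix (Fin (m + 1)) (Fin n) ℝ := fun p => (b p : Fin n → ℝ)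
    obtain ⟨hli, hspan⟩ := basis_rows b
    have hA : ∀ c : Fin (m + 1) → ℝ, SignChangesAtMost n m (Matrix.vecMul c A) := fun c =>
      h _ (by rw [← hspan]; exact (mem_span_rows_iff A _).2 ⟨c, rfl⟩)
    by_cases hneg : ∃ f : Fin (m + 1) → Fin n, StrictMono f ∧ (A.submatrix id f).det < 0
    · obtain ⟨f, hf, hf0⟩ := hneg
      let w : Fin (m + 1) → ℝˣ := Function.update 1 0 (-1)
      obtain ⟨hli', hspan'⟩ := basis_rows (b.unitsSMul w)
      refine ⟨fun p => (b.unitsSMul w p : Fin n → ℝ), hli', hspan', fun g hg => ?_⟩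
      have e : (Matrix.submatrix (fun p => (b.unitsSMul w p : Fin n → ℝ)) id g).det =
          (∏ p, (w p : ℝ)) * (A.submatrix id g).det := by
        rw [← Matrix.det_mul_column]
        congr 1
        ext p j
        simp [A, Module.Basis.unitsSMul_apply, Units.smul_def]
        rfl
      have hw : ∏ p, (w p : ℝ) = -1 := by
        rw [Fin.prod_univ_succ]
        simp [w]
      rw [e, hw]
      by_contra hc
      have hg0 : 0 < (A.submatrix id g).det := by linarith
      have := minors_mul_pos A hA f g hf hg hf0.ne hg0.ne'
      nlinarith
    · push Not at hneg
      exact ⟨A, hli, hspan, hneg⟩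
end

section
/- Let 0 ≤ k < n and let S, S′ ⊆ ℂ be sets with |S| = |S′| = k. If V_S = V_{S′} as subspaces of ℂⁿ, then S = S′. -/
open scoped BigOperators

/-- If the moment vector of `z` lies in `V_S` and `S` has fewer than `n` elements, then `z ∈ S`. -/
theorem mem_of_moment_mem_VS {n : ℕ} {S : Finset ℂ} (hS : S.card < n) {z : ℂ}
    (hz : (fun j : Fin n => z ^ (j : ℕ)) ∈ VS n S) : z ∈ S := by
  set P : Polynomial ℂ := ∏ w ∈ S, (Polynomial.X - Polynomial.C w) with hP
  have hdeg : P.natDegree < n := by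
    rw [hP, Polynomial.natDegree_finsetProd_X_sub_C_eq_card]
    exact hS
  have heval (x : ℂ) : ∑ j : Fin n, P.coeff j * x ^ (j : ℕ) = P.eval x := by
    rw [Polynomial.eval_eq_sum_range' hdeg, Finset.sum_range]
  have hvanish : ∀ v ∈ VS n S, ∑ j : Fin n, P.coeff j * v j = 0 := by
    intro v hv
    induction hv using Submodule.span_induction with
    | mem v hv =>
      obtain ⟨w, hw, rfl⟩ := hv
      rw [heval, hP, Polynomial.eval_prod]
      exact Finset.prod_eq_zero hw (by simp)
    | zero => simp
    | add u v _ _ hu hv => simp [mul_add, Finset.sum_add_distrib, hu, hv]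
    | smul c v _ hv =>
      simp only [Pi.smul_apply, smul_eq_mul, mul_left_comm _ c]
      rw [← Finset.mul_sum, hv, mul_zero]
  have hroot := hvanish _ hz
  rw [heval, hP, Polynomial.eval_prod, Finset.prod_eq_zero_iff] at hroot
  obtain ⟨w, hw, hzw⟩ := hroot
  have : z = w := by simpa [sub_eq_zero] using hzw
  exact this ▸ hw

/-- for `0 ≤ k < n`, if `S, S'` are `k`-element subsets of `ℂ`
with `V_S = V_{S'}` in `ℂⁿ`, then `S = S'`. -/
theorem VS_injective (k n : ℕ) (hkn : k < n) (S S' : Finset ℂ)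
    (hS : S.card = k) (hS' : S'.card = k) (h : VS n S = VS n S') : S = S' := by
  refine Finset.eq_of_subset_of_card_le (fun z hz => ?_) (by rw [hS, hS'])
  refine mem_of_moment_mem_VS (hS'.trans_lt hkn) ?_
  rw [← h]
  exact Submodule.subset_span ⟨z, hz, rfl⟩
end

section
/- Let m ≥ 0, k = 2m+1, and θ₁,…,θ_k ∈ ℝ. Then the determinant of the k×k real matrix whose s-th column is (1, cos θ_s, sin θ_s, cos 2θ_s, sin 2θ_s, …, cos(mθ_s), sin(mθ_s)) equals 2^{2m²} · ∏_{1≤r<s≤k} sin((θ_s−θ_r)/2). -/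
open scoped BigOperators

namespace TrigMoment

/-- Coefficient of `exp (i j θ)`, `j = (r + 1) / 2`, in the `r`-th element of the
basis `1, cos θ, sin θ, cos 2θ, sin 2θ, …` of trigonometric polynomials. -/
noncomputable def posCoeff (r : ℕ) : ℂ :=
  if r = 0 then 1 else if r % 2 = 1 then 1 / 2 else -Complex.I / 2

/-- Coefficient of `exp (-i j θ)`, `j = (r + 1) / 2`, in the `r`-th element of the
basis `1, cos θ, sin θ, cos 2θ, sin 2θ, …`; it is `0` for `r = 0`. -/
noncomputable def negCoeff (r : ℕ) : ℂ :=
  if r = 0 then 0 else if r % 2 = 1 then 1 / 2 else Complex.I / 2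

/-- Expansion of `1, cos θ, sin θ, cos 2θ, …` in the exponentials `exp (i (c - m) θ)`. -/
noncomputable def transition (n m : ℕ) : Matrix (Fin n) (Fin n) ℂ :=
  Matrix.of fun r c =>
    (if (c : ℕ) = m + ((r : ℕ) + 1) / 2 then posCoeff r else 0) +
      (if (c : ℕ) + ((r : ℕ) + 1) / 2 = m then negCoeff r else 0)

theorem transition_rotate (m : ℕ) :
    ((transition (2 * m + 1 + 2) (m + 1)).submatrix id (finRotate (2 * m + 1 + 2))).submatrix
        finSumFinEquiv finSumFinEquiv =
      Matrix.fromBlocks (transition (2 * m + 1) m) 0 0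
        !![1 / 2, 1 / 2; -Complex.I / 2, Complex.I / 2] := by
  have hl : ∀ c : Fin (2 * m + 1),
      ((finRotate (2 * m + 1 + 2) (Fin.castAdd 2 c) : Fin _) : ℕ) = c + 1 := fun c => by
    rw [coe_finRotate_of_ne_last]
    · simp
    · intro h
      have := congrArg Fin.val h
      simp at this
      omega
  have h0 : ((finRotate (2 * m + 1 + 2) (Fin.natAdd (2 * m + 1) 0) : Fin _) : ℕ)
      = 2 * m + 2 := by
    rw [coe_finRotate_of_ne_last]
    · simp
    · intro h
      have := congrArg Fin.val h
      simp at this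
  have h1 : ((finRotate (2 * m + 1 + 2) (Fin.natAdd (2 * m + 1) 1) : Fin _) : ℕ) = 0 := by
    have : Fin.natAdd (2 * m + 1) (1 : Fin 2) = Fin.last (2 * m + 1 + 1) := by
      ext; simp
    rw [this, finRotate_last]; simp
  ext (r | r) (c | c)
  · simp only [Matrix.submatrix_apply, Matrix.fromBlocks_apply₁₁, transition, Matrix.of_apply,
      finSumFinEquiv_apply_left, hl, id, Fin.val_castAdd]
    congr 2 <;> apply propext <;> omega
  · have hr := r.2
    fin_cases c <;>
    simp only [Matrix.submatrix_apply, Matrix.fromBlocks_apply₁₂, transition, Matrix.of_apply,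
      finSumFinEquiv_apply_left, finSumFinEquiv_apply_right, Fin.zero_eta, Fin.mk_one, h0, h1,
      id, Fin.val_castAdd, Matrix.zero_apply] <;>
    rw [if_neg (by omega), if_neg (by omega), add_zero]
  · have hc := c.2
    fin_cases r <;>
    simp only [Matrix.submatrix_apply, Matrix.fromBlocks_apply₂₁, transition, Matrix.of_apply,
      finSumFinEquiv_apply_left, finSumFinEquiv_apply_right, Fin.zero_eta, Fin.mk_one, hl,
      id, Fin.val_natAdd, Fin.val_zero, Fin.val_one, Matrix.zero_apply] <;>
    rw [if_neg (by omega), if_neg (by omega), add_zero]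
  · have e3 : 2 * m + 2 = m + 1 + (m + 1) := by omega
    have e1 : (m + 1 + (m + 1)) / 2 = m + 1 := by omega
    have e2 : (m + 1 + (m + 1) + 1) / 2 = m + 1 := by omega
    have p1 : (2 * m + 1) % 2 = 1 := by omega
    have p2 : (m + 1 + (m + 1)) % 2 = 0 := by omega
    fin_cases r <;> fin_cases c <;>
    simp only [Matrix.submatrix_apply, Matrix.fromBlocks_apply₂₂, transition, Matrix.of_apply,
      finSumFinEquiv_apply_right, Fin.zero_eta, Fin.mk_one, h0, h1, id, Fin.val_natAdd,
      Fin.val_zero, Fin.val_one, add_zero, e3, posCoeff, negCoeff] <;>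
    simp [e1, e2, p1, p2]

theorem det_transition (m : ℕ) : (transition (2 * m + 1) m).det = (Complex.I / 2) ^ m := by
  induction m with
  | zero => simp [transition, posCoeff, negCoeff]
  | succ m ih =>
    have h := congrArg Matrix.det (transition_rotate m)
    rw [Matrix.det_submatrix_equiv_self, Matrix.det_permute', sign_finRotate,
      Matrix.det_fromBlocks_zero₂₁, ih, Matrix.det_fin_two_of] at h
    have hs : (-1 : ℂ) ^ (2 * m + 2) = 1 :=
      Even.neg_one_pow ⟨m + 1, by omega⟩
    change (transition (2 * m + 1 + 2) (m + 1)).det = _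
    simp only [Nat.reduceSubDiff, Units.val_pow_eq_pow_val, Units.val_neg,
      Units.val_one, Int.cast_pow, Int.cast_neg, Int.cast_one, hs, one_mul] at h
    rw [h]
    ring

theorem transition_mul (m : ℕ) (θ : Fin (2 * m + 1) → ℝ) :
    transition (2 * m + 1) m *
        (Matrix.projVandermonde (fun s => Complex.exp ((θ s / 2 : ℝ) * Complex.I))
          (fun s => Complex.exp (-(θ s / 2 : ℝ) * Complex.I))).transpose =
      (Matrix.of fun r s : Fin (2 * m + 1) =>
        if (r : ℕ) = 0 then (1 : ℝ)
        else if (r : ℕ) % 2 = 1 then Real.cos (((((r : ℕ) + 1) / 2 : ℕ) : ℝ) * θ s)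
        else Real.sin ((((r : ℕ) / 2 : ℕ) : ℝ) * θ s)).map Complex.ofRealHom := by
  ext r s
  obtain ⟨r, hr⟩ := r
  set j := (r + 1) / 2 with hj
  have hjm : j ≤ m := by omega
  have c1 : ∀ c : Fin (2 * m + 1), ((c : ℕ) = m + j) ↔ c = ⟨m + j, by omega⟩ := fun c => by
    rw [Fin.ext_iff]
  have c2 : ∀ c : Fin (2 * m + 1), ((c : ℕ) + j = m) ↔ c = ⟨m - j, by omega⟩ := fun c => by
    rw [Fin.ext_iff]; simp only; omega
  have hp : Complex.exp ((θ s / 2 : ℝ) * Complex.I) ^ (m + j) *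
      Complex.exp (-(θ s / 2 : ℝ) * Complex.I) ^ (m - j) =
        Complex.exp ((j * θ s : ℂ) * Complex.I) := by
    rw [← Complex.exp_nat_mul, ← Complex.exp_nat_mul, ← Complex.exp_add]
    congr 1
    push_cast [hjm]
    ring
  have hn : Complex.exp ((θ s / 2 : ℝ) * Complex.I) ^ (m - j) *
      Complex.exp (-(θ s / 2 : ℝ) * Complex.I) ^ (m + j) =
        Complex.exp (-(j * θ s : ℂ) * Complex.I) := by
    rw [← Complex.exp_nat_mul, ← Complex.exp_nat_mul, ← Complex.exp_add]
    congr 1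
    push_cast [hjm]
    ring
  have r1 : ((⟨m + j, by omega⟩ : Fin (2 * m + 1)).rev : ℕ) = m - j := by
    simp [Fin.val_rev]; omega
  have r2 : ((⟨m - j, by omega⟩ : Fin (2 * m + 1)).rev : ℕ) = m + j := by
    simp [Fin.val_rev]; omega
  simp only [Matrix.mul_apply, Matrix.transpose_apply, Matrix.projVandermonde_apply, transition,
    Matrix.of_apply, ← hj, c1, c2, add_mul, ite_mul, zero_mul, Finset.sum_add_distrib,
    Finset.sum_ite_eq', Finset.mem_univ, if_true, r1, r2, hp, hn,
    Matrix.map_apply, Complex.ofRealHom_eq_coe]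
  unfold posCoeff negCoeff
  split_ifs with h0 hodd
  · have : j = 0 := by omega
    simp [this]
  · rw [Complex.ofReal_cos, Complex.cos]
    push_cast
    ring
  · have : r / 2 = j := by omega
    rw [this, Complex.ofReal_sin, Complex.sin]
    push_cast
    ring

theorem exp_mul_exp_sub (a b : ℝ) :
    Complex.exp ((b / 2 : ℝ) * Complex.I) * Complex.exp (-(a / 2 : ℝ) * Complex.I) -
      Complex.exp ((a / 2 : ℝ) * Complex.I) * Complex.exp (-(b / 2 : ℝ) * Complex.I) =
        2 * Complex.I * (Real.sin ((b - a) / 2) : ℂ) := by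
  rw [Complex.ofReal_sin, mul_assoc, mul_comm Complex.I, ← mul_assoc, Complex.two_sin,
    mul_assoc, Complex.I_mul_I, ← Complex.exp_add, ← Complex.exp_add]
  push_cast
  ring_nf

theorem prod_prod_Ioi_const {M : Type*} [CommMonoid M] (n : ℕ) (c : M) :
    ∏ i : Fin n, ∏ _j ∈ Finset.Ioi i, c = c ^ (n * (n - 1) / 2) := by
  simp only [Finset.prod_const, Fin.card_Ioi]
  rw [Finset.prod_pow_eq_pow_sum, ← Finset.sum_range_id,
    Fin.sum_univ_eq_sum_range (fun i => n - 1 - i), Finset.sum_range_reflect (fun i => i)]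

end TrigMoment

/-- for `k = 2m+1` odd, the determinant of the matrix whose `s`-th column is
`(1, cos θ_s, sin θ_s, …, cos(m θ_s), sin(m θ_s))` equals
`2^(2m²) ∏_{r<s} sin((θ_s − θ_r)/2)`. -/
theorem det_trig_moment_odd (m : ℕ) (θ : Fin (2 * m + 1) → ℝ) :
    (Matrix.of fun r s : Fin (2 * m + 1) =>
        if (r : ℕ) = 0 then (1 : ℝ)
        else if (r : ℕ) % 2 = 1 then Real.cos (((((r : ℕ) + 1) / 2 : ℕ) : ℝ) * θ s)
        else Real.sin ((((r : ℕ) / 2 : ℕ) : ℝ) * θ s)).det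
      = 2 ^ (2 * m ^ 2) *
          ∏ r : Fin (2 * m + 1), ∏ s ∈ Finset.Ioi r, Real.sin ((θ s - θ r) / 2) := by
  apply Complex.ofReal_injective
  have h := congrArg Matrix.det (TrigMoment.transition_mul m θ)
  rw [Matrix.det_mul, TrigMoment.det_transition, Matrix.det_transpose, Matrix.det_projVandermonde,
    ← RingHom.mapMatrix_apply, ← RingHom.map_det] at h
  simp only [TrigMoment.exp_mul_exp_sub, Finset.prod_mul_distrib] at h
  rw [TrigMoment.prod_prod_Ioi_const, TrigMoment.prod_prod_Ioi_const, ← mul_pow] at h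
  rw [Complex.ofRealHom_eq_coe] at h
  rw [← h]
  have e : (2 * m + 1) * (2 * m + 1 - 1) / 2 = 2 * m ^ 2 + m := by
    rw [Nat.add_sub_cancel]
    apply Nat.div_eq_of_eq_mul_left two_pos
    ring
  have hc : (Complex.I / 2) ^ m * (2 * Complex.I) ^ (2 * m ^ 2 + m) = 2 ^ (2 * m ^ 2) := by
    have hI : Complex.I ^ (2 * m ^ 2 + 2 * m) = 1 := by
      rw [show 2 * m ^ 2 + 2 * m = 2 * (m * (m + 1)) by ring, pow_mul, Complex.I_sq]
      exact (Nat.even_mul_succ_self m).neg_one_pow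
    calc (Complex.I / 2) ^ m * (2 * Complex.I) ^ (2 * m ^ 2 + m)
        = 2 ^ (2 * m ^ 2) * ((2⁻¹ * 2) ^ m * Complex.I ^ (2 * m ^ 2 + 2 * m)) := by
          rw [div_eq_mul_inv, mul_pow, mul_pow, mul_pow]; ring_nf
      _ = 2 ^ (2 * m ^ 2) := by rw [hI]; norm_num
  rw [e, ← mul_assoc, hc]
  push_cast
  rfl
end

section
/- Let m ≥ 1, k = 2m, and θ₁,…,θ_k ∈ ℝ. Then the determinant of the k×k real matrix whose s-th column is (cos(θ_s/2), sin(θ_s/2), cos(3θ_s/2), sin(3θ_s/2), …, cos((2m−1)θ_s/2), sin((2m−1)θ_s/2)) equals 2^{2m²−2m} · ∏_{1≤r<s≤k} sin((θ_s−θ_r)/2). -/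
open scoped BigOperators

/-- The coefficient of `exp ((2j-(2m-1))ix)` in `cos ((2l+1)x)` for `r = 2l`, and in
`sin ((2l+1)x)` for `r = 2l+1`. -/
noncomputable def trigCoeffEntry (m r j : ℕ) : ℂ :=
  (if j = m + r / 2 then if r % 2 = 0 then 1 / 2 else -Complex.I / 2 else 0) +
    (if j + r / 2 + 1 = m then if r % 2 = 0 then 1 / 2 else Complex.I / 2 else 0)

/-- The matrix expressing `cos ((2l+1)x)` and `sin ((2l+1)x)`, for `l < m`, in terms of the
exponentials `exp ((2j-(2m-1))ix)`, for `j < 2m`. -/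
noncomputable def trigCoeff (m : ℕ) : Matrix (Fin (2 * m)) (Fin (2 * m)) ℂ :=
  Matrix.of fun r j => trigCoeffEntry m r j

theorem coe_finRotate_castAdd_two {n : ℕ} (j : Fin n) :
    (finRotate (n + 2) (Fin.castAdd 2 j) : ℕ) = j + 1 := by
  rw [coe_finRotate_of_ne_last]
  · rfl
  · intro h
    have := congrArg Fin.val h
    rw [Fin.val_castAdd, Fin.val_last] at this
    omega

theorem coe_finRotate_natAdd_zero (n : ℕ) :
    (finRotate (n + 2) (Fin.natAdd n (0 : Fin 2)) : ℕ) = n + 1 := by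
  rw [coe_finRotate_of_ne_last]
  · rfl
  · intro h
    have := congrArg Fin.val h
    rw [Fin.val_natAdd, Fin.val_last] at this
    simp at this

theorem coe_finRotate_natAdd_one (n : ℕ) :
    (finRotate (n + 2) (Fin.natAdd n (1 : Fin 2)) : ℕ) = 0 := by
  rw [show Fin.natAdd n (1 : Fin 2) = Fin.last (n + 1) from rfl, finRotate_last]
  rfl

theorem trigCoeff_succ_submatrix (m : ℕ) :
    ((trigCoeff (m + 1)).submatrix id (finRotate (2 * m + 2))).submatrix
        (finSumFinEquiv (m := 2 * m) (n := 2)) (finSumFinEquiv (m := 2 * m) (n := 2)) =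
      Matrix.fromBlocks (trigCoeff m) 0 0 !![1 / 2, 1 / 2; -Complex.I / 2, Complex.I / 2] := by
  ext (r | r) (j | j)
  · change trigCoeffEntry (m + 1) r (finRotate (2 * m + 2) (Fin.castAdd 2 j) : Fin (2 * m + 2)) =
      trigCoeffEntry m r j
    have h1 : (j : ℕ) + 1 = m + 1 + r / 2 ↔ (j : ℕ) = m + r / 2 := by omega
    have h2 : (j : ℕ) + 1 + r / 2 + 1 = m + 1 ↔ (j : ℕ) + r / 2 + 1 = m := by omega
    simp only [coe_finRotate_castAdd_two, trigCoeffEntry, h1, h2]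
  · change trigCoeffEntry (m + 1) r (finRotate (2 * m + 2) (Fin.natAdd (2 * m) j) : Fin (2 * m + 2))
      = 0
    have : j = 0 ∨ j = 1 := by omega
    rcases this with rfl | rfl
    · rw [coe_finRotate_natAdd_zero, trigCoeffEntry, if_neg (by omega), if_neg (by omega), add_zero]
    · rw [coe_finRotate_natAdd_one, trigCoeffEntry, if_neg (by omega), if_neg (by omega), add_zero]
  · change trigCoeffEntry (m + 1) (2 * m + r)
      (finRotate (2 * m + 2) (Fin.castAdd 2 j) : Fin (2 * m + 2)) = 0
    rw [coe_finRotate_castAdd_two, trigCoeffEntry, if_neg (by omega), if_neg (by omega), add_zero]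
  · change trigCoeffEntry (m + 1) (2 * m + r)
      (finRotate (2 * m + 2) (Fin.natAdd (2 * m) j) : Fin (2 * m + 2)) =
      !![1 / 2, 1 / 2; -Complex.I / 2, Complex.I / 2] r j
    have hr : (2 * m + (r : ℕ)) / 2 = m := by omega
    have hr' : (2 * m + (r : ℕ)) % 2 = r := by omega
    have : j = 0 ∨ j = 1 := by omega
    rcases this with rfl | rfl
    · rw [coe_finRotate_natAdd_zero, trigCoeffEntry, hr, hr', if_pos (by omega),
        if_neg (show ¬ 2 * m + 1 + m + 1 = m + 1 by omega), add_zero]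
      fin_cases r <;> simp
    · rw [coe_finRotate_natAdd_one, trigCoeffEntry, hr, hr', if_neg (by omega),
        if_pos (by omega), zero_add]
      fin_cases r <;> simp

theorem det_trigCoeff (m : ℕ) : (trigCoeff m).det = (-Complex.I / 2) ^ m := by
  induction m with
  | zero => simp
  | succ m ih =>
    have h := congrArg Matrix.det (trigCoeff_succ_submatrix m)
    rw [Matrix.det_submatrix_equiv_self, Matrix.det_fromBlocks_zero₂₁, ih,
      Matrix.det_fin_two_of] at h
    have h' := Matrix.det_permute' (finRotate (2 * m + 2)) (trigCoeff (m + 1))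
    rw [sign_finRotate] at h'
    have e : (trigCoeff (m + 1)).det = -((-Complex.I / 2) ^ m *
        (1 / 2 * (Complex.I / 2) - 1 / 2 * (-Complex.I / 2))) := by
      rw [← h]
      refine (neg_eq_iff_eq_neg.mpr ?_).symm
      refine h'.trans ?_
      rw [show 2 * m + 2 - 1 = 2 * m + 1 from rfl, Odd.neg_one_pow ⟨m, rfl⟩]
      push_cast
      exact neg_one_mul _
    rw [e]
    ring

theorem trigCoeff_mul_projVandermonde (m : ℕ) (θ : Fin (2 * m) → ℝ) :
    trigCoeff m * (Matrix.projVandermonde (fun s => Complex.exp (θ s / 2 * Complex.I))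
        fun s => Complex.exp (-(θ s / 2 * Complex.I))).transpose =
      (Matrix.of fun r s : Fin (2 * m) =>
        if (r : ℕ) % 2 = 0 then Real.cos ((((r : ℕ) : ℝ) + 1) * θ s / 2)
        else Real.sin (((r : ℕ) : ℝ) * θ s / 2)).map Complex.ofRealHom := by
  ext r s
  obtain ⟨l, hl⟩ : ∃ l, l = (r : ℕ) / 2 := ⟨_, rfl⟩
  have hlm : l < m := by omega
  have key (j : Fin (2 * m)) :
      (Matrix.projVandermonde (fun s => Complex.exp (θ s / 2 * Complex.I))
        fun s => Complex.exp (-(θ s / 2 * Complex.I))).transpose j s =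
      Complex.exp ((2 * (j : ℕ) + 1 - 2 * m) * (θ s / 2 * Complex.I)) := by
    rw [Matrix.transpose_apply, Matrix.projVandermonde_apply, ← Complex.exp_nat_mul,
      ← Complex.exp_nat_mul, ← Complex.exp_add, Fin.val_rev,
      Nat.cast_sub (by omega)]
    congr 1
    push_cast
    ring
  have hl1 : m + l < 2 * m := by omega
  have hl2 : m - 1 - l < 2 * m := by omega
  have h1 (j : Fin (2 * m)) : (j : ℕ) = m + l ↔ j = ⟨m + l, hl1⟩ := by
    rw [Fin.ext_iff]
  have h2 (j : Fin (2 * m)) : (j : ℕ) + l + 1 = m ↔ j = ⟨m - 1 - l, hl2⟩ := by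
    rw [Fin.ext_iff]
    simp only
    omega
  have hc : ((m - 1 - l : ℕ) : ℂ) = m - 1 - l := by
    rw [Nat.cast_sub (by omega), Nat.cast_sub (by omega)]
    simp
  rw [Matrix.mul_apply]
  simp only [key, trigCoeff, trigCoeffEntry, Matrix.of_apply, ← hl, h1, h2, add_mul, ite_mul, zero_mul,
    Finset.sum_add_distrib, Finset.sum_ite_eq', Finset.mem_univ, if_true]
  rw [hc, Matrix.map_apply, Matrix.of_apply]
  have a1 : ((2 * ((m + l : ℕ) : ℂ) + 1 - 2 * m) * (θ s / 2 * Complex.I)) =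
    ((2 * l + 1) * θ s / 2) * Complex.I := by push_cast; ring
  have a2 : ((2 * ((m : ℂ) - 1 - l) + 1 - 2 * m) * (θ s / 2 * Complex.I)) =
    -((2 * l + 1) * θ s / 2) * Complex.I := by ring
  rw [a1, a2]
  split_ifs with hr
  · have : ((r : ℕ) : ℂ) = 2 * l := by
      have : (r : ℕ) = 2 * l := by omega
      rw [this]; push_cast; ring
    simp only [Complex.ofRealHom_eq_coe]
    push_cast
    rw [this, Complex.cos]
    ring_nf
  · have : ((r : ℕ) : ℂ) = 2 * l + 1 := by
      have : (r : ℕ) = 2 * l + 1 := by omega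
      rw [this]; push_cast; ring
    simp only [Complex.ofRealHom_eq_coe]
    push_cast
    rw [this, Complex.sin]
    ring_nf

theorem prod_Ioi_const {M : Type*} [CommMonoid M] (n : ℕ) (c : M) :
    ∏ r : Fin n, ∏ _s ∈ Finset.Ioi r, c = c ^ (n * (n - 1) / 2) := by
  simp only [Finset.prod_const, Fin.card_Ioi]
  rw [Finset.prod_pow_eq_pow_sum, ← Finset.sum_range_id_mul_two, Nat.mul_div_cancel _ two_pos,
    ← Finset.sum_range_reflect, Finset.sum_range]

/-- for `k = 2m` even, the determinant of the matrix whose `s`-th column is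
`(cos(θ_s/2), sin(θ_s/2), …, cos((2m−1)θ_s/2), sin((2m−1)θ_s/2))` equals
`2^(2m²−2m) ∏_{r<s} sin((θ_s − θ_r)/2)`. -/
theorem det_sym_moment_even (m : ℕ) (hm : 1 ≤ m) (θ : Fin (2 * m) → ℝ) :
    (Matrix.of fun r s : Fin (2 * m) =>
        if (r : ℕ) % 2 = 0 then Real.cos ((((r : ℕ) : ℝ) + 1) * θ s / 2)
        else Real.sin (((r : ℕ) : ℝ) * θ s / 2)).det
      = 2 ^ (2 * m ^ 2 - 2 * m) *
          ∏ r : Fin (2 * m), ∏ s ∈ Finset.Ioi r, Real.sin ((θ s - θ r) / 2) := by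
  apply Complex.ofReal_injective
  have h := congrArg Matrix.det (trigCoeff_mul_projVandermonde m θ)
  rw [Matrix.det_mul, det_trigCoeff, Matrix.det_transpose, Matrix.det_projVandermonde] at h
  have hs (r s : Fin (2 * m)) :
      Complex.exp (θ s / 2 * Complex.I) * Complex.exp (-(θ r / 2 * Complex.I)) -
        Complex.exp (θ r / 2 * Complex.I) * Complex.exp (-(θ s / 2 * Complex.I)) =
      2 * Complex.I * Real.sin ((θ s - θ r) / 2) := by
    have hI : (2 : ℂ) * Complex.I * Complex.I = -2 := by
      rw [mul_assoc, Complex.I_mul_I]; ring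
    rw [← Complex.exp_add, ← Complex.exp_add, Complex.ofReal_sin, Complex.sin, mul_div_assoc',
      ← mul_assoc, mul_right_comm, hI]
    push_cast
    ring_nf
  rw [Finset.prod_congr rfl fun r _ => (Finset.prod_congr rfl fun s _ => hs r s).trans
    Finset.prod_mul_distrib, Finset.prod_mul_distrib, prod_Ioi_const] at h
  rw [← RingHom.mapMatrix_apply, ← RingHom.map_det] at h
  refine h.symm.trans ?_
  obtain ⟨n, rfl⟩ : ∃ n, m = n + 1 := ⟨m - 1, by omega⟩
  have e1 : 2 * (n + 1) * (2 * (n + 1) - 1) / 2 = (n + 1) + 2 * (n * (n + 1)) := by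
    rw [mul_assoc, Nat.mul_div_cancel_left _ two_pos,
      show 2 * (n + 1) - 1 = 2 * n + 1 by omega]
    ring
  have e2 : 2 * (n + 1) ^ 2 - 2 * (n + 1) = 2 * (n * (n + 1)) := by
    rw [show 2 * (n + 1) ^ 2 = 2 * (n * (n + 1)) + 2 * (n + 1) by ring, Nat.add_sub_cancel]
  have hI : -Complex.I / 2 * (2 * Complex.I) = 1 := by
    linear_combination -Complex.I_mul_I
  have hI2 : (2 * Complex.I) ^ (2 * (n * (n + 1))) = 2 ^ (2 * (n * (n + 1))) := by
    rw [mul_pow, pow_mul Complex.I, Complex.I_sq, (Nat.even_mul_succ_self n).neg_one_pow, mul_one]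
  rw [e1, e2, pow_add (2 * Complex.I), hI2, ← mul_assoc, ← mul_assoc, ← mul_pow, hI, one_pow, one_mul]
  push_cast
  rfl
end

section
/- Let 1 ≤ k ≤ n and θ ∈ ℝ, and let A_θ be the k×n real matrix whose j-th column is f_k(θ + 2πj/n) for 1 ≤ j ≤ n. Then for every choice of columns i₁ < i₂ < … < i_k in {1,…,n}, the k×k minor of A_θ in columns i₁,…,i_k equals 2^{⌊(k−1)²/2⌋} · ∏_{1≤r<s≤k} sin((i_s−i_r)π/n); in particular every such minor is strictly positive. -/
open scoped BigOperators

/-- The curve `f_k : ℝ → ℝ^k`: the trigonometric moment curve (with constant first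
coordinate) for odd `k`, and the symmetric moment curve for even `k`. -/
noncomputable def fcurve (k : ℕ) (θ : ℝ) : Fin k → ℝ := fun r =>
  if k % 2 = 1 then
    (if (r : ℕ) = 0 then (1 : ℝ)
     else if (r : ℕ) % 2 = 1 then Real.cos (((((r : ℕ) + 1) / 2 : ℕ) : ℝ) * θ)
     else Real.sin ((((r : ℕ) / 2 : ℕ) : ℝ) * θ))
  else
    (if (r : ℕ) % 2 = 0 then Real.cos ((((r : ℕ) : ℝ) + 1) * θ / 2)
     else Real.sin (((r : ℕ) : ℝ) * θ / 2))
/-- The coordinates of `f_k` are linear combinations of the `k` exponentials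
`exp (i (2 c + 1 - k) x / 2)`; the determinant of the change of basis is explicit. -/
theorem exists_fcurve_eq_sum_exp : ∀ k : ℕ, ∃ T : Matrix (Fin k) (Fin k) ℂ,
    T.det * (2 * Complex.I) ^ (k.choose 2) = 2 ^ ((k - 1) ^ 2 / 2) ∧
    ∀ (x : ℝ) (r : Fin k), (fcurve k x r : ℂ) =
      ∑ c : Fin k, T r c * Complex.exp (Complex.I * (2 * (c : ℕ) + 1 - k) * x / 2)
  | 0 => ⟨1, by simp, fun _ r => r.elim0⟩
  | 1 => ⟨1, by simp, fun x r => by 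
      obtain rfl : r = 0 := Subsingleton.elim _ _
      simp [fcurve]⟩
  | k + 2 => by
    obtain ⟨T, hdet, hT⟩ := exists_fcurve_eq_sum_exp k
    let B : Matrix (Fin 2) (Fin 2) ℂ := !![1 / 2, 1 / 2; -Complex.I / 2, Complex.I / 2]
    let M : Matrix (Fin (k + 2)) (Fin (k + 2)) ℂ :=
      Matrix.reindex finSumFinEquiv finSumFinEquiv (Matrix.fromBlocks T 0 0 B)
    have hMdet : M.det = T.det * (Complex.I / 2) := by
      simp only [M, Matrix.det_reindex_self, Matrix.det_fromBlocks_zero₂₁, B,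
        Matrix.det_fin_two_of]
      ring
    refine ⟨M.submatrix id (finRotate (k + 2)).symm, ?_, fun x r => ?_⟩
    · have h1 : (k + 2).choose 2 = k.choose 2 + (2 * k + 1) := by
        rw [Nat.choose_succ_succ' (k + 1) 1, Nat.choose_succ_succ' k 1]
        simp
        ring
      have h2 : (k + 2 - 1) ^ 2 / 2 = (k - 1) ^ 2 / 2 + 2 * k := by
        rcases k with _ | k
        · simp
        · have : (k + 1 + 2 - 1) ^ 2 = (k + 1 - 1) ^ 2 + 2 * (2 * (k + 1)) := by
            simp
            ring
          omega
      have h3 : (-1 : ℂ) ^ (k + 1) * (Complex.I / 2) * (2 * Complex.I) ^ (2 * k + 1)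
          = 2 ^ (2 * k) := by
        rw [pow_succ (2 * Complex.I), mul_pow, pow_mul Complex.I, Complex.I_sq,
          pow_succ (-1 : ℂ)]
        have h4 : (-1 : ℂ) ^ k * (-1 : ℂ) ^ k = 1 := by
          rw [← mul_pow]; simp
        linear_combination (-2 ^ (2 * k) * Complex.I ^ 2) * h4 - 2 ^ (2 * k) * Complex.I_sq
      rw [Matrix.det_permute', hMdet, Equiv.Perm.sign_symm, sign_finRotate, h1, h2,
        pow_add (2 * Complex.I), pow_add (2 : ℂ), ← hdet, ← h3]
      push_cast
      ring
    · have hrot (a : Fin k) : ((finRotate (k + 2) (Fin.castAdd 2 a) : Fin (k + 2)) : ℕ) = a + 1 :=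
        coe_finRotate_of_ne_last (by simp [Fin.ext_iff]; omega)
      have hrot0 : ((finRotate (k + 2) (Fin.natAdd k 0) : Fin (k + 2)) : ℕ) = k + 1 :=
        coe_finRotate_of_ne_last (by simp [Fin.ext_iff])
      have hrot1 : ((finRotate (k + 2) (Fin.natAdd k 1) : Fin (k + 2)) : ℕ) = 0 := by
        rw [show (Fin.natAdd k 1 : Fin (k + 2)) = Fin.last (k + 1) from rfl, finRotate_last]
        rfl
      rw [← Equiv.sum_comp (finRotate (k + 2)) fun c => _,
        ← Equiv.sum_comp finSumFinEquiv fun c => _,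
        Fintype.sum_sum_type, Fin.sum_univ_two]
      obtain ⟨r, rfl⟩ := finSumFinEquiv.surjective r
      simp only [M, Matrix.submatrix_apply, id_eq, Equiv.symm_apply_apply, Matrix.reindex_apply,
        finSumFinEquiv_apply_left, finSumFinEquiv_apply_right, hrot, hrot0, hrot1]
      simp only [← finSumFinEquiv_apply_left, ← finSumFinEquiv_apply_right,
        Equiv.symm_apply_apply]
      have hpos : Complex.exp (Complex.I * (2 * ((k + 1 : ℕ) : ℂ) + 1 - ((k + 2 : ℕ) : ℂ)) * x / 2)
          = Complex.exp (((k + 1 : ℝ) / 2 * x : ℝ) * Complex.I) := by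
        congr 1
        push_cast
        ring
      have hneg : Complex.exp (Complex.I * (2 * ((0 : ℕ) : ℂ) + 1 - ((k + 2 : ℕ) : ℂ)) * x / 2)
          = Complex.exp (-((k + 1 : ℝ) / 2 * x : ℝ) * Complex.I) := by
        congr 1
        push_cast
        ring
      rcases r with r | r
      · simp only [Matrix.fromBlocks_apply₁₁, Matrix.fromBlocks_apply₁₂, Matrix.zero_apply,
          zero_mul, add_zero, finSumFinEquiv_apply_left]
        have : fcurve (k + 2) x (Fin.castAdd 2 r) = fcurve k x r := by
          simp [fcurve]
        rw [this, hT]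
        refine Finset.sum_congr rfl fun c _ => ?_
        push_cast
        ring_nf
      · simp only [Matrix.fromBlocks_apply₂₁, Matrix.fromBlocks_apply₂₂, Matrix.zero_apply,
          zero_mul, Finset.sum_const_zero, zero_add, finSumFinEquiv_apply_right, hpos, hneg]
        have hcos := Complex.two_cos (((k + 1 : ℝ) / 2 * x : ℝ) : ℂ)
        have hsin := Complex.two_sin (((k + 1 : ℝ) / 2 * x : ℝ) : ℂ)
        fin_cases r
        · have : fcurve (k + 2) x (Fin.natAdd k 0) = Real.cos ((k + 1 : ℝ) / 2 * x) := by
            simp only [fcurve, Fin.val_natAdd]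
            rcases Nat.even_or_odd' k with ⟨m, rfl | rfl⟩
            · rw [if_neg (by omega), if_pos (by simp)]
              congr 1
              push_cast [Fin.val_zero, Fin.val_one]
              ring
            · rw [if_pos (by omega), if_neg (by simp), if_pos (by simp),
                show (2 * m + 1 + ((0 : Fin 2) : ℕ) + 1) / 2 = m + 1 by simp; omega]
              congr 1
              push_cast
              ring
          simp only [Fin.zero_eta, this, B, Complex.ofReal_cos, Matrix.of_apply,
            Matrix.cons_val_zero, Matrix.cons_val_one]
          linear_combination hcos / 2
        · have : fcurve (k + 2) x (Fin.natAdd k 1) = Real.sin ((k + 1 : ℝ) / 2 * x) := by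
            simp only [fcurve, Fin.val_natAdd]
            rcases Nat.even_or_odd' k with ⟨m, rfl | rfl⟩
            · rw [if_neg (by omega), if_neg (by simp)]
              congr 1
              push_cast [Fin.val_zero, Fin.val_one]
              ring
            · rw [if_pos (by omega), if_neg (by simp), if_neg (by simp; omega),
                show (2 * m + 1 + ((1 : Fin 2) : ℕ)) / 2 = m + 1 by simp; omega]
              congr 1
              push_cast
              ring
          simp only [Fin.mk_one, this, B, Complex.ofReal_sin, Matrix.of_apply,
            Matrix.cons_val_zero, Matrix.cons_val_one]
          linear_combination hsin / 2

/-- The determinant of `f_k` evaluated at `k` points. -/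
theorem det_fcurve (k : ℕ) (x : Fin k → ℝ) :
    (Matrix.of fun r j : Fin k => fcurve k (x j) r).det =
      2 ^ ((k - 1) ^ 2 / 2) *
        ∏ r : Fin k, ∏ s ∈ Finset.Ioi r, Real.sin ((x s - x r) / 2) := by
  obtain ⟨T, hdet, hT⟩ := exists_fcurve_eq_sum_exp k
  have hE : (Matrix.of fun c j : Fin k =>
      Complex.exp (Complex.I * (2 * (c : ℕ) + 1 - k) * x j / 2)).det =
      (2 * Complex.I) ^ (k.choose 2) *
        ∏ r : Fin k, ∏ s ∈ Finset.Ioi r, (Real.sin ((x s - x r) / 2) : ℂ) := by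
    have hV : (Matrix.of fun c j : Fin k =>
        Complex.exp (Complex.I * (2 * (c : ℕ) + 1 - k) * x j / 2)) =
        Matrix.of fun c j : Fin k => Complex.exp (-(Complex.I * (k - 1) * x j / 2)) *
          (Matrix.vandermonde fun j => Complex.exp (Complex.I * x j)).transpose c j := by
      ext c j
      simp only [Matrix.of_apply, Matrix.transpose_apply, Matrix.vandermonde_apply,
        ← Complex.exp_nat_mul, ← Complex.exp_add]
      congr 1
      ring
    have hpair (r s : Fin k) : Complex.exp (Complex.I * x s) - Complex.exp (Complex.I * x r) =
        Complex.exp (Complex.I * (x r + x s) / 2) *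
          (2 * Complex.I * (Real.sin ((x s - x r) / 2) : ℂ)) := by
      rw [Complex.ofReal_sin, mul_right_comm, Complex.two_sin, mul_assoc,
        Complex.I_mul_I, mul_neg_one, neg_sub, mul_sub, ← Complex.exp_add, ← Complex.exp_add]
      congr 2 <;> push_cast <;> ring
    rw [hV, Matrix.det_mul_row, Matrix.det_transpose, Matrix.det_vandermonde]
    simp only [hpair, Finset.prod_mul_distrib]
    simp only [← Complex.exp_sum]
    rw [← mul_assoc, ← Complex.exp_add]
    have hexp : ∑ j : Fin k, -(Complex.I * (k - 1) * x j / 2) +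
        ∑ r : Fin k, ∑ s ∈ Finset.Ioi r, Complex.I * (x r + x s) / 2 = 0 := by
      have h1 : ∑ r : Fin k, ∑ s ∈ Finset.Ioi r, Complex.I * (x s : ℂ) / 2 =
          ∑ s : Fin k, (s : ℕ) * (Complex.I * (x s : ℂ) / 2) := by
        rw [Finset.sum_comm' (t' := Finset.univ) (s' := fun s => Finset.Iio s) (by simp)]
        simp
      have h2 : ∑ r : Fin k, ∑ s ∈ Finset.Ioi r, Complex.I * (x r : ℂ) / 2 =
          ∑ r : Fin k, (k - 1 - (r : ℕ)) * (Complex.I * (x r : ℂ) / 2) := by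
        refine Finset.sum_congr rfl fun r _ => ?_
        have hr : 1 + (r : ℕ) ≤ k := by omega
        rw [Finset.sum_const, Fin.card_Ioi, nsmul_eq_mul, Nat.sub_sub, Nat.cast_sub hr]
        push_cast
        ring
      simp only [mul_add, add_div, Finset.sum_add_distrib, h1, h2]
      rw [← Finset.sum_add_distrib, ← Finset.sum_add_distrib]
      refine Finset.sum_eq_zero fun r _ => ?_
      ring
    have hcard : ∑ r : Fin k, (Finset.Ioi r).card = k.choose 2 := by
      simp only [Fin.card_Ioi]
      rw [Fin.sum_univ_eq_sum_range fun r => k - 1 - r, Finset.sum_range_reflect fun r => r,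
        Finset.sum_range_id, Nat.choose_two_right]
    rw [hexp, Complex.exp_zero, one_mul]
    simp only [Finset.prod_const, Finset.prod_pow_eq_pow_sum, hcard, mul_pow]
  have hF : (Matrix.of fun r j : Fin k => fcurve k (x j) r).map (algebraMap ℝ ℂ) =
      T * Matrix.of fun c j : Fin k =>
        Complex.exp (Complex.I * (2 * (c : ℕ) + 1 - k) * x j / 2) := by
    ext r j
    simpa [Matrix.mul_apply] using hT (x j) r
  have h := congrArg Matrix.det hF
  rw [Matrix.det_mul, hE, ← mul_assoc, hdet, ← RingHom.mapMatrix_apply, ← RingHom.map_det] at h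
  apply Complex.ofReal_injective
  push_cast at h ⊢
  exact h

/-- the `k × k` minors of the matrix `A_θ` with columns
`f_k(θ + 2πj/n)`, `1 ≤ j ≤ n`, in increasing columns `i₁ < ⋯ < i_k`, equal
`2^⌊(k−1)²/2⌋ ∏_{r<s} sin((i_s − i_r)π/n)`; in particular they are positive. -/
theorem minors_of_Atheta (k n : ℕ) (hk : 1 ≤ k) (hkn : k ≤ n) (θ : ℝ)
    (A : Matrix (Fin k) (Fin n) ℝ)
    (hA : A = Matrix.of fun (r : Fin k) (j : Fin n) =>
      fcurve k (θ + 2 * Real.pi * (((j : ℕ) : ℝ) + 1) / n) r)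
    (g : Fin k → Fin n) (hg : StrictMono g) :
    (A.submatrix id g).det
        = 2 ^ ((k - 1) ^ 2 / 2) *
            ∏ r : Fin k, ∏ s ∈ Finset.Ioi r,
              Real.sin ((((g s : ℕ) : ℝ) - ((g r : ℕ) : ℝ)) * Real.pi / n) ∧
      0 < (A.submatrix id g).det := by
  subst hA
  have hn : (0 : ℝ) < n := by exact_mod_cast hk.trans hkn
  have hdet : ((Matrix.of fun (r : Fin k) (j : Fin n) =>
      fcurve k (θ + 2 * Real.pi * (((j : ℕ) : ℝ) + 1) / n) r).submatrix id g).det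
        = 2 ^ ((k - 1) ^ 2 / 2) *
            ∏ r : Fin k, ∏ s ∈ Finset.Ioi r,
              Real.sin ((((g s : ℕ) : ℝ) - ((g r : ℕ) : ℝ)) * Real.pi / n) := by
    refine (det_fcurve k fun j => θ + 2 * Real.pi * (((g j : ℕ) : ℝ) + 1) / n).trans ?_
    refine congrArg _ (Finset.prod_congr rfl fun r _ => Finset.prod_congr rfl fun s _ => ?_)
    congr 1
    ring
  refine ⟨hdet, hdet ▸ ?_⟩
  refine mul_pos (by positivity) (Finset.prod_pos fun r _ => Finset.prod_pos fun s hs => ?_)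
  have h1 : ((g r : ℕ) : ℝ) < (g s : ℕ) := by exact_mod_cast hg (Finset.mem_Ioi.mp hs)
  have h2 : ((g s : ℕ) : ℝ) < n := by exact_mod_cast (g s).isLt
  have h3 : (0 : ℝ) ≤ (g r : ℕ) := by positivity
  apply Real.sin_pos_of_pos_of_lt_pi
  · have := sub_pos.mpr h1
    positivity
  · rw [div_lt_iff₀ hn, mul_comm]
    exact mul_lt_mul_of_pos_left (by linarith) Real.pi_pos
end

section
/- Let 1 ≤ k ≤ n. For every θ ∈ ℝ, the ℂ-linear span of the rows (viewed as vectors in ℂⁿ) of the k×n real matrix A_θ whose j-th column is f_k(θ + 2πj/n) equals V₀. -/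
open scoped BigOperators

/-- The argument `θ + 2π(j+1)/n` at which `fcurve` is evaluated in the `j`-th column. -/
noncomputable def columnAngle (n : ℕ) (θ : ℝ) (j : Fin n) : ℝ :=
  θ + 2 * Real.pi * (((j : ℕ) : ℝ) + 1) / n

/-- The vector `(exp(i m x_j / 2))_j`, where `x_j` is the `j`-th column angle. -/
noncomputable def expRow (n : ℕ) (θ : ℝ) (m : ℤ) : Fin n → ℂ := fun j =>
  Complex.exp (m * (columnAngle n θ j / 2) * Complex.I)

/-- The vector `(cos(m x_j / 2))_j`, where `x_j` is the `j`-th column angle. -/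
noncomputable def cosRow (n : ℕ) (θ : ℝ) (m : ℕ) : Fin n → ℂ := fun j =>
  Complex.cos (m * (columnAngle n θ j / 2))

/-- The vector `(sin(m x_j / 2))_j`, where `x_j` is the `j`-th column angle. -/
noncomputable def sinRow (n : ℕ) (θ : ℝ) (m : ℕ) : Fin n → ℂ := fun j =>
  Complex.sin (m * (columnAngle n θ j / 2))

lemma expRow_natCast (n : ℕ) (θ : ℝ) (m : ℕ) :
    expRow n θ m = cosRow n θ m + Complex.I • sinRow n θ m := by
  funext j
  simp [expRow, cosRow, sinRow, Complex.exp_mul_I, mul_comm Complex.I]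

lemma expRow_neg_natCast (n : ℕ) (θ : ℝ) (m : ℕ) :
    expRow n θ (-m) = cosRow n θ m - Complex.I • sinRow n θ m := by
  funext j
  simp only [expRow, Complex.exp_mul_I]
  simp [cosRow, sinRow, mul_comm Complex.I, sub_eq_add_neg]

lemma cosRow_eq (n : ℕ) (θ : ℝ) (m : ℕ) :
    cosRow n θ m = (1 / 2 : ℂ) • (expRow n θ m + expRow n θ (-m)) := by
  rw [expRow_natCast, expRow_neg_natCast]
  module

lemma sinRow_eq (n : ℕ) (θ : ℝ) (m : ℕ) :
    sinRow n θ m = (-Complex.I / 2) • (expRow n θ m - expRow n θ (-m)) := by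
  rw [expRow_natCast, expRow_neg_natCast]
  funext j
  simp only [Pi.smul_apply, Pi.sub_apply, Pi.add_apply, smul_eq_mul]
  linear_combination sinRow n θ m j * Complex.I_sq

lemma expRow_eq_smul_pow (n : ℕ) (θ : ℝ) (m : ℤ) :
    expRow n θ m = Complex.exp (m * ((θ + 2 * Real.pi / n) / 2) * Complex.I) •
      fun j : Fin n => Complex.exp (Complex.I * (m * Real.pi / n)) ^ (j : ℕ) := by
  funext j
  rw [Pi.smul_apply, smul_eq_mul, ← Complex.exp_nat_mul, ← Complex.exp_add, expRow, columnAngle]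
  push_cast
  congr 1
  ring

/-- `V₀` is spanned by the exponential rows of frequencies `(2j + 1 - k) / 2`, `j < k`. -/
lemma VS_S0_eq_span_expRow (k n : ℕ) (θ : ℝ) :
    VS n (S0 k n) =
      Submodule.span ℂ (Set.range fun j : Fin k => expRow n θ (2 * (j : ℕ) + 1 - k)) := by
  have hS : (S0 k n : Set ℂ) = Set.range fun j : Fin k =>
      Complex.exp (Complex.I * (((2 * (j : ℕ) + 1 - k : ℤ) : ℂ) * Real.pi / n)) := by
    ext z
    simp [S0]
  rw [VS, hS, ← Set.range_comp]
  apply le_antisymm <;> rw [Submodule.span_le] <;> rintro _ ⟨j, rfl⟩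
  · have h := Submodule.subset_span (R := ℂ)
      (Set.mem_range_self (f := fun j : Fin k => expRow n θ (2 * (j : ℕ) + 1 - k)) j)
    simp only [expRow_eq_smul_pow] at h ⊢
    exact (Submodule.smul_mem_iff _ (Complex.exp_ne_zero _)).1 h
  · simp only [expRow_eq_smul_pow]
    exact Submodule.smul_mem _ _ (Submodule.subset_span ⟨j, rfl⟩)

lemma expRow_mem_VS_S0 {k : ℕ} (n : ℕ) (θ : ℝ) {m : ℤ} (hm : |m| < k) (hpar : 2 ∣ m + k - 1) :
    expRow n θ m ∈ VS n (S0 k n) := by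
  obtain ⟨l, hl⟩ := hpar
  rw [abs_lt] at hm
  lift l to ℕ using by lia
  rw [VS_S0_eq_span_expRow k n θ]
  refine Submodule.subset_span ⟨⟨l, by lia⟩, ?_⟩
  have h : 2 * (l : ℤ) + 1 - k = m := by lia
  simp [h]

lemma cosRow_mem_VS_S0 {k : ℕ} (n : ℕ) (θ : ℝ) {m : ℕ} (hm : m < k) (hpar : (m + 1) % 2 = k % 2) :
    cosRow n θ m ∈ VS n (S0 k n) := by
  rw [cosRow_eq]
  exact Submodule.smul_mem _ _ (Submodule.add_mem _
    (expRow_mem_VS_S0 n θ (by rw [abs_lt]; lia) (by lia))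
    (expRow_mem_VS_S0 n θ (by rw [abs_lt]; lia) (by lia)))

lemma sinRow_mem_VS_S0 {k : ℕ} (n : ℕ) (θ : ℝ) {m : ℕ} (hm : m < k) (hpar : (m + 1) % 2 = k % 2) :
    sinRow n θ m ∈ VS n (S0 k n) := by
  rw [sinRow_eq]
  exact Submodule.smul_mem _ _ (Submodule.sub_mem _
    (expRow_mem_VS_S0 n θ (by rw [abs_lt]; lia) (by lia))
    (expRow_mem_VS_S0 n θ (by rw [abs_lt]; lia) (by lia)))

lemma sinRow_zero (n : ℕ) (θ : ℝ) : sinRow n θ 0 = 0 := by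
  funext j
  simp [sinRow]

/-- The `p`-th row of the matrix with columns `fcurve k x_j`, `x_j` the column angles. -/
noncomputable def fcurveRow (k n : ℕ) (θ : ℝ) (p : Fin k) : Fin n → ℂ := fun j =>
  ((fcurve k (columnAngle n θ j) p : ℝ) : ℂ)

lemma fcurveRow_eq_cosRow {k : ℕ} (n : ℕ) (θ : ℝ) {m : ℕ} (hm : m < k)
    (hpar : (m + 1) % 2 = k % 2) :
    fcurveRow k n θ ⟨m - 1, by lia⟩ = cosRow n θ m := by
  funext j
  rcases Nat.even_or_odd' m with ⟨l, rfl | rfl⟩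
  · have hk : k % 2 = 1 := by lia
    rcases l with _ | l
    · simp [fcurveRow, fcurve, cosRow, hk]
    · have h1 : 2 * (l + 1) - 1 = 2 * l + 1 := by lia
      have h2 : (2 * l + 1) % 2 = 1 := by lia
      have h3 : (2 * l + 1 + 1) / 2 = l + 1 := by lia
      simp only [fcurveRow, fcurve, cosRow, hk, h1, h2, h3, if_true, Nat.succ_ne_zero, if_false]
      push_cast
      congr 1
      ring
  · have hk : ¬ k % 2 = 1 := by lia
    have h1 : 2 * l + 1 - 1 = 2 * l := by lia
    simp only [fcurveRow, fcurve, cosRow, hk, h1, Nat.mul_mod_right, if_true, if_false]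
    push_cast
    congr 1
    ring

lemma fcurveRow_eq_sinRow {k : ℕ} (n : ℕ) (θ : ℝ) {m : ℕ} (hm : m < k)
    (hpar : (m + 1) % 2 = k % 2) (h0 : m ≠ 0) :
    fcurveRow k n θ ⟨m, hm⟩ = sinRow n θ m := by
  funext j
  rcases Nat.even_or_odd' m with ⟨l, rfl | rfl⟩
  · have hk : k % 2 = 1 := by lia
    have h1 : ¬ 2 * l % 2 = 1 := by lia
    have h2 : 2 * l / 2 = l := by lia
    simp only [fcurveRow, fcurve, sinRow, hk, h0, h1, h2, if_true, if_false]
    push_cast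
    congr 1
    ring
  · have hk : ¬ k % 2 = 1 := by lia
    have h1 : ¬ (2 * l + 1) % 2 = 0 := by lia
    simp only [fcurveRow, fcurve, sinRow, hk, h1, if_false]
    push_cast
    congr 1
    ring

lemma fcurveRow_mem_VS_S0 {k : ℕ} (n : ℕ) (θ : ℝ) (p : Fin k) :
    fcurveRow k n θ p ∈ VS n (S0 k n) := by
  obtain ⟨p, hp⟩ := p
  by_cases hpar : (p + 1) % 2 = k % 2
  · by_cases h0 : p = 0
    · subst h0
      have h := cosRow_mem_VS_S0 n θ hp hpar
      rwa [← fcurveRow_eq_cosRow n θ hp hpar] at h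
    · rw [fcurveRow_eq_sinRow n θ hp hpar h0]
      exact sinRow_mem_VS_S0 n θ hp hpar
  · have hp' : p + 1 < k := by lia
    have hpar' : (p + 1 + 1) % 2 = k % 2 := by lia
    have h := cosRow_mem_VS_S0 n θ hp' hpar'
    rwa [← fcurveRow_eq_cosRow n θ hp' hpar'] at h

lemma expRow_mem_span_fcurveRow {k : ℕ} (n : ℕ) (θ : ℝ) {m : ℤ} (hm : |m| < k)
    (hpar : 2 ∣ m + k - 1) :
    expRow n θ m ∈ Submodule.span ℂ (Set.range (fcurveRow k n θ)) := by
  have key (l : ℕ) (hl : l < k) (hpar : (l + 1) % 2 = k % 2) :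
      cosRow n θ l ∈ Submodule.span ℂ (Set.range (fcurveRow k n θ)) ∧
      Complex.I • sinRow n θ l ∈ Submodule.span ℂ (Set.range (fcurveRow k n θ)) := by
    constructor
    · rw [← fcurveRow_eq_cosRow n θ hl hpar]
      exact Submodule.subset_span ⟨_, rfl⟩
    · refine Submodule.smul_mem _ _ ?_
      rcases eq_or_ne l 0 with rfl | h0
      · rw [sinRow_zero]
        exact Submodule.zero_mem _
      · rw [← fcurveRow_eq_sinRow n θ hl hpar h0]
        exact Submodule.subset_span ⟨_, rfl⟩
  rw [abs_lt] at hm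
  obtain ⟨l, rfl | rfl⟩ := m.eq_nat_or_neg
  · have h := key l (by lia) (by lia)
    rw [expRow_natCast]
    exact Submodule.add_mem _ h.1 h.2
  · have h := key l (by lia) (by lia)
    rw [expRow_neg_natCast]
    exact Submodule.sub_mem _ h.1 h.2

/-- for every `θ ∈ ℝ`, the complex span of the rows of the matrix
`A_θ` with columns `f_k(θ + 2πj/n)`, `1 ≤ j ≤ n`, equals `V₀ = V_{S₀}`. -/
theorem span_rows_Atheta_eq_V0 (k n : ℕ) (hk : 1 ≤ k) (hkn : k ≤ n) (θ : ℝ) :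
    Submodule.span ℂ (Set.range fun p : Fin k =>
        fun j : Fin n =>
          ((fcurve k (θ + 2 * Real.pi * (((j : ℕ) : ℝ) + 1) / n) p : ℝ) : ℂ))
      = VS n (S0 k n) := by
  change Submodule.span ℂ (Set.range (fcurveRow k n θ)) = _
  apply le_antisymm
  · rw [Submodule.span_le]
    rintro _ ⟨p, rfl⟩
    exact fcurveRow_mem_VS_S0 n θ p
  · rw [VS_S0_eq_span_expRow k n θ, Submodule.span_le]
    rintro _ ⟨j, rfl⟩
    have hj := j.isLt
    exact expRow_mem_span_fcurveRow n θ (by rw [abs_lt]; lia) (by lia)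
end

section
/- Let 1 ≤ k ≤ n with n ≥ 2. Suppose V ⊆ ℂⁿ is a k-dimensional totally nonnegative subspace and z ∈ ℂ with z ≠ 0 is such that (1, z, z², …, z^{n−1}) ∈ V. Then |arg(z)| ≤ (k−1)π/(n−1), where arg : ℂ× → (−π, π] is the principal argument. -/
open scoped BigOperators

open Matrix Function

lemma StrictMono.update_of_forall {ι α : Type*} [LinearOrder ι] [Preorder α] {g : ι → α}
    (hg : StrictMono g) {i : ι} {p : α} (hlt : ∀ j, j < i → g j < p)
    (hgt : ∀ j, i < j → p < g j) : StrictMono (update g i p) := by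
  intro a b hab
  by_cases ha : a = i
  · subst ha
    simpa [update_of_ne hab.ne'] using hgt b hab
  · by_cases hb : b = i
    · subst hb
      simpa [update_of_ne ha] using hlt a hab
    · simpa [update_of_ne ha, update_of_ne hb] using hg hab

/-- The `ℓ¹` distance between two tuples of indices. -/
def tupleDist {k n : ℕ} (g h : Fin k → Fin n) : ℕ :=
  ∑ j, ((g j : ℤ) - (h j : ℤ)).natAbs

lemma tupleDist_update_lt {k n : ℕ} {g h : Fin k → Fin n} {i : Fin k} {p : Fin n}
    (hp : ((p : ℤ) - (h i : ℤ)).natAbs < ((g i : ℤ) - (h i : ℤ)).natAbs) :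
    tupleDist (update g i p) h < tupleDist g h := by
  refine Finset.sum_lt_sum (fun j _ => ?_) ⟨i, Finset.mem_univ i, by simpa using hp⟩
  rcases eq_or_ne j i with rfl | hj
  · simpa using hp.le
  · simp [update_of_ne hj]

/-- Two distinct increasing tuples can be brought closer by moving one entry of the first
by one step. -/
lemma exists_update_tupleDist_lt {k n : ℕ} {g h : Fin k → Fin n} (hg : StrictMono g)
    (hh : StrictMono h) (hne : g ≠ h) :
    ∃ (i : Fin k) (p : Fin n), StrictMono (update g i p) ∧
      ((p : ℕ) = g i + 1 ∨ (p : ℕ) + 1 = g i) ∧ tupleDist (update g i p) h < tupleDist g h := by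
  by_cases hup : ∃ i, g i < h i
  · obtain ⟨i, hi⟩ := (Set.toFinite {i | g i < h i}).exists_maximal hup
    have hlt : g i < h i := hi.prop
    have hmax : ∀ j, i < j → h j ≤ g j := fun j hj => by
      by_contra! hc
      exact absurd (hi.le_of_ge (y := j) hc hj.le) (not_le.2 hj)
    refine ⟨i, ⟨g i + 1, by have := (h i).isLt; omega⟩, ?_, Or.inl rfl, tupleDist_update_lt ?_⟩
    · refine hg.update_of_forall (fun j hj => ?_) fun j hj => ?_
      · have := hg hj
        simp only [Fin.lt_def] at *
        omega
      · have h1 := hmax j hj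
        have h2 := hh hj
        simp only [Fin.lt_def, Fin.le_def] at *
        omega
    · simp only [Fin.lt_def] at hlt
      push_cast
      omega
  · push Not at hup
    have hdown : ∃ i, h i < g i := by
      by_contra! hc
      exact hne (funext fun i => le_antisymm (hc i) (hup i))
    obtain ⟨i, hi⟩ := (Set.toFinite {i | h i < g i}).exists_minimal hdown
    have hlt : h i < g i := hi.prop
    have hmin : ∀ j, j < i → g j ≤ h j := fun j hj => by
      by_contra! hc
      exact absurd (hi.le_of_le (y := j) hc hj.le) (not_le.2 hj)
    have hpos : (0 : ℕ) < g i := by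
      simp only [Fin.lt_def] at hlt
      omega
    refine ⟨i, ⟨g i - 1, by have := (g i).isLt; omega⟩, ?_, Or.inr (by simp; omega),
      tupleDist_update_lt ?_⟩
    · refine hg.update_of_forall (fun j hj => ?_) fun j hj => ?_
      · have h1 := hmin j hj
        have h2 := hh hj
        simp only [Fin.lt_def, Fin.le_def] at *
        omega
      · have := hg hj
        simp only [Fin.lt_def] at *
        omega
    · simp only [Fin.lt_def] at hlt
      simp only
      omega

/-- The matrix obtained from `A` by adding `t` times column `p` to column `q`. -/
def addCol {k n : ℕ} (A : Matrix (Fin k) (Fin n) ℝ) (q p : Fin n) (t : ℝ) :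
    Matrix (Fin k) (Fin n) ℝ :=
  A.updateCol q (A.col q + t • A.col p)

lemma vecMul_addCol {k n : ℕ} (A : Matrix (Fin k) (Fin n) ℝ) (q p : Fin n) (t : ℝ)
    (c : Fin k → ℝ) (j : Fin n) :
    (c ᵥ* addCol A q p t) j = (c ᵥ* A) j + t * (if j = q then (c ᵥ* A) p else 0) := by
  by_cases hj : j = q
  · subst hj
    simp [addCol, vecMul, dotProduct, mul_add, Finset.sum_add_distrib, Finset.mul_sum,
      mul_left_comm]
  · simp [addCol, vecMul, dotProduct, hj]

lemma det_addCol_of_notMem {k n : ℕ} (A : Matrix (Fin k) (Fin n) ℝ) {q p : Fin n} (t : ℝ)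
    {g : Fin k → Fin n} (hq : ∀ i, g i ≠ q) :
    ((addCol A q p t).submatrix id g).det = (A.submatrix id g).det := by
  congr 1
  ext r s
  simp [addCol, hq s]

lemma det_addCol_of_mem {k n : ℕ} (A : Matrix (Fin k) (Fin n) ℝ) (p : Fin n) (t : ℝ)
    {g : Fin k → Fin n} (hg : Injective g) (i : Fin k) :
    ((addCol A (g i) p t).submatrix id g).det =
      (A.submatrix id g).det + t * (A.submatrix id (update g i p)).det := by
  have h1 : (addCol A (g i) p t).submatrix id g =
      (A.submatrix id g).updateCol i (A.col (g i) + t • A.col p) := by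
    ext r s
    by_cases hs : s = i
    · subst hs
      simp [addCol]
    · simp [addCol, hs, hg.ne hs]
  have h2 : (A.submatrix id g).updateCol i (A.col (g i)) = A.submatrix id g := by
    ext r s
    by_cases hs : s = i
    · subst hs
      simp
    · simp [hs]
  have h3 : (A.submatrix id g).updateCol i (A.col p) = A.submatrix id (update g i p) := by
    ext r s
    by_cases hs : s = i
    · subst hs
      simp
    · simp [hs]
  rw [h1, det_updateCol_add, det_updateCol_smul, h2, h3]

/-- Adding a nonnegative multiple of a column to an adjacent one preserves nonnegativity of the
maximal minors. -/
lemma det_addCol_nonneg {k n : ℕ} {A : Matrix (Fin k) (Fin n) ℝ}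
    (hA : ∀ g : Fin k → Fin n, StrictMono g → 0 ≤ (A.submatrix id g).det) {q p : Fin n}
    (hpq : (p : ℕ) = q + 1 ∨ (p : ℕ) + 1 = q) {t : ℝ} (ht : 0 ≤ t)
    (g : Fin k → Fin n) (hg : StrictMono g) :
    0 ≤ ((addCol A q p t).submatrix id g).det := by
  by_cases hq : ∀ i, g i ≠ q
  · rw [det_addCol_of_notMem A t hq]
    exact hA g hg
  push Not at hq
  obtain ⟨i, rfl⟩ := hq
  rw [det_addCol_of_mem A p t hg.injective i]
  refine add_nonneg (hA g hg) (mul_nonneg ht ?_)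
  by_cases hp : ∃ j, g j = p
  · obtain ⟨j, rfl⟩ := hp
    have hji : j ≠ i := by
      rintro rfl
      omega
    refine (det_zero_of_column_eq (i := i) (j := j) hji.symm fun r => ?_).ge
    simp [update_of_ne hji]
  · push Not at hp
    refine hA _ (hg.update_of_forall (fun j hj => ?_) fun j hj => ?_)
    all_goals
      have h1 := hg hj
      have h2 := Fin.val_ne_of_ne (hp j)
      simp only [Fin.lt_def] at *
      omega

/-- If the minor of `A` omitting the last of `k + 1` columns is positive, a vector in the row span
cannot strictly alternate in sign along these columns. -/
lemma not_alternating_of_det_pos {k n : ℕ} {A : Matrix (Fin k) (Fin n) ℝ}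
    (hA : ∀ g : Fin k → Fin n, StrictMono g → 0 ≤ (A.submatrix id g).det)
    {J : Fin (k + 1) → Fin n} (hJ : StrictMono J)
    (hpos : 0 < (A.submatrix id (J ∘ Fin.castSucc)).det) (c : Fin k → ℝ)
    (hc : ∀ i : Fin (k + 1), 0 < (-1) ^ (i : ℕ) * (c ᵥ* A) (J i)) : False := by
  let M : Matrix (Fin (k + 1)) (Fin (k + 1)) ℝ :=
    Matrix.of (Fin.cons (fun j => (c ᵥ* A) (J j)) fun r j => A r (J j))
  have hdet : M.det = 0 := by
    refine exists_vecMul_eq_zero_iff.1 ⟨Fin.cons 1 (-c), fun h => ?_, ?_⟩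
    · simpa using congrFun h 0
    · ext j
      simp [M, vecMul, dotProduct, Fin.sum_univ_succ]
  have hminor : ∀ j : Fin (k + 1), M.submatrix Fin.succ j.succAbove =
      A.submatrix id (J ∘ j.succAbove) := fun j => by
    ext r s
    simp [M]
  rw [det_succ_row_zero] at hdet
  refine (Finset.sum_pos' (fun j _ => ?_) ⟨Fin.last k, Finset.mem_univ _, ?_⟩).ne' hdet
  · rw [hminor]
    exact mul_nonneg (hc j).le (hA _ (hJ.comp j.strictMono_succAbove))
  · rw [hminor, Fin.succAbove_last]
    exact mul_pos (hc (Fin.last k)) hpos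

/-- Variation diminishing property: if all maximal minors of `A` are nonnegative and one of them
is positive, then no vector in the row span strictly alternates in sign along `k + 1` columns. -/
theorem not_alternating_of_det_nonneg {k n : ℕ} {A : Matrix (Fin k) (Fin n) ℝ}
    (hA : ∀ g : Fin k → Fin n, StrictMono g → 0 ≤ (A.submatrix id g).det)
    {J : Fin (k + 1) → Fin n} (hJ : StrictMono J) {g : Fin k → Fin n} (hg : StrictMono g)
    (hpos : 0 < (A.submatrix id g).det) (c : Fin k → ℝ)
    (hc : ∀ i : Fin (k + 1), 0 < (-1) ^ (i : ℕ) * (c ᵥ* A) (J i)) : False := by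
  induction hd : tupleDist g (J ∘ Fin.castSucc) using Nat.strong_induction_on generalizing A g with
  | _ d ih =>
  by_cases hgJ : g = J ∘ Fin.castSucc
  · subst hgJ
    exact not_alternating_of_det_pos hA hJ hpos c hc
  obtain ⟨i, p, hmono, hp, hlt⟩ :=
    exists_update_tupleDist_lt hg (hJ.comp Fin.strictMono_castSucc) hgJ
  have hev : ∀ᶠ t : ℝ in nhdsWithin 0 (Set.Ioi 0), ∀ j : Fin (k + 1),
      0 < (-1) ^ (j : ℕ) * (c ᵥ* addCol A p (g i) t) (J j) := by
    refine Filter.eventually_all.2 fun j => ?_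
    have hcont : Continuous fun t : ℝ => (-1) ^ (j : ℕ) * (c ᵥ* addCol A p (g i) t) (J j) := by
      simp only [vecMul_addCol]
      fun_prop
    refine (hcont.tendsto 0).mono_left nhdsWithin_le_nhds |>.eventually_const_lt ?_
    simpa [vecMul_addCol] using hc j
  obtain ⟨t, ht, (htpos : 0 < t)⟩ := (hev.and self_mem_nhdsWithin).exists
  refine ih _ (hd ▸ hlt) (A := addCol A p (g i) t)
    (fun g' hg' => det_addCol_nonneg hA (by omega) htpos.le g' hg') hmono ?_ ht rfl
  have hdet := det_addCol_of_mem A (g i) t hmono.injective i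
  rw [update_self, update_idem, update_eq_self] at hdet
  rw [hdet]
  exact add_pos_of_nonneg_of_pos (hA _ hmono) (mul_pos htpos hpos)

lemma exists_strictMono_det_ne_zero {k n : ℕ} {A : Matrix (Fin k) (Fin n) ℝ}
    (hA : LinearIndependent ℝ A.row) :
    ∃ g : Fin k → Fin n, StrictMono g ∧ (A.submatrix id g).det ≠ 0 := by
  obtain ⟨f, hf, -, hli⟩ := Submodule.exists_fun_fin_finrank_span_eq ℝ (Set.range A.col)
  choose q hq using hf
  have hqinj : Injective q := fun a b hab => hli.injective (by rw [← hq a, ← hq b, hab])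
  have hcard : (Finset.univ.image q).card = k := by
    rw [Finset.card_image_of_injective _ hqinj, Finset.card_univ, Fintype.card_fin,
      ← rank_eq_finrank_span_cols, hA.rank_matrix, Fintype.card_fin]
  have hmem := (Finset.univ.image q).orderEmbOfFin_mem hcard
  generalize (Finset.univ.image q).orderEmbOfFin hcard = g at hmem
  refine ⟨g, g.strictMono, ?_⟩
  simp only [Finset.mem_image, Finset.mem_univ, true_and] at hmem
  choose e he using hmem
  have hcols : LinearIndependent ℝ (A.submatrix id g).col := by
    have heq : (A.submatrix id g).col = f ∘ e := by
      funext i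
      rw [Function.comp_apply, ← hq, he]
      rfl
    rw [heq]
    exact hli.comp e fun a b hab => g.injective (by rw [← he a, ← he b, hab])
  exact ((isUnit_iff_isUnit_det _).1 (linearIndependent_cols_iff_isUnit.1 hcols)).ne_zero

lemma linearIndependent_row_of_rowsC {k n : ℕ} {A : Matrix (Fin k) (Fin n) ℝ}
    (hA : LinearIndependent ℂ (rowsC A)) : LinearIndependent ℝ A.row := by
  rw [Fintype.linearIndependent_iff] at hA ⊢
  intro c hc i
  have := hA (fun i => (c i : ℂ)) (by
    ext j
    have := congrFun hc j
    simp only [Finset.sum_apply, Pi.smul_apply, smul_eq_mul, Pi.zero_apply, row] at this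
    simp only [rowsC, Finset.sum_apply, Pi.smul_apply, smul_eq_mul, Pi.zero_apply]
    exact_mod_cast this) i
  exact_mod_cast this

/-- Imaginary parts of complex multiples of a vector in the complex row span lie in the real row
span. -/
lemma exists_vecMul_eq_im {k n : ℕ} {A : Matrix (Fin k) (Fin n) ℝ} {w : Fin n → ℂ}
    (hw : w ∈ Submodule.span ℂ (Set.range (rowsC A))) (a : ℂ) :
    ∃ c : Fin k → ℝ, ∀ j, (c ᵥ* A) j = (a * w j).im := by
  obtain ⟨b, rfl⟩ := (Submodule.mem_span_range_iff_exists_fun ℂ).1 hw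
  refine ⟨fun p => (a * b p).im, fun j => ?_⟩
  simp only [vecMul, dotProduct, rowsC, Finset.sum_apply, Pi.smul_apply, smul_eq_mul,
    Finset.mul_sum, Complex.im_sum, ← mul_assoc, Complex.im_mul_ofReal]

/-- An arithmetic progression with step at most `π` reaching beyond `(k - 1)π` meets each of the
first `k + 1` intervals `((i - 1)π, iπ]`. -/
lemma exists_mem_Ioc_nat_mul_pi {k n : ℕ} {θ : ℝ} (hθ : θ ≤ Real.pi)
    (h : ((k : ℝ) - 1) * Real.pi < ((n : ℝ) - 1) * θ) (hθ0 : 0 < θ) (hn : 0 < n)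
    (i : Fin (k + 1)) :
    ∃ j : Fin n, ((i : ℝ) - 1) * Real.pi < j * θ ∧ (j : ℝ) * θ ≤ i * Real.pi := by
  have hpi := Real.pi_pos
  obtain ⟨i, hi⟩ := i
  cases i with
  | zero => exact ⟨⟨0, hn⟩, by simp [hpi], by simp⟩
  | succ m =>
    have hx : 0 ≤ m * Real.pi / θ := by positivity
    have hle := Nat.floor_le hx
    have hlt := Nat.lt_floor_add_one (m * Real.pi / θ)
    rw [le_div_iff₀ hθ0] at hle
    rw [div_lt_iff₀ hθ0] at hlt
    have hmk : (m : ℝ) + 1 ≤ k := by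
      exact_mod_cast Nat.lt_succ_iff.1 hi
    refine ⟨⟨⌊m * Real.pi / θ⌋₊ + 1, ?_⟩, ?_, ?_⟩
    · have h1 : (⌊m * Real.pi / θ⌋₊ : ℝ) * θ < ((n : ℝ) - 1) * θ := by
        refine hle.trans_lt (lt_of_le_of_lt ?_ h)
        gcongr
        linarith
      have h2 := lt_of_mul_lt_mul_right h1 hθ0.le
      have h3 : ((⌊m * Real.pi / θ⌋₊ + 1 : ℕ) : ℝ) < n := by
        push_cast
        linarith
      exact_mod_cast h3
    · push_cast
      linarith
    · push_cast
      linarith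

/-- Sampling the sine along such a progression produces `k` strict sign changes. -/
lemma exists_alternating_sin {k n : ℕ} {θ : ℝ} (hθ : θ ≤ Real.pi)
    (h : ((k : ℝ) - 1) * Real.pi < ((n : ℝ) - 1) * θ) (hθ0 : 0 < θ) (hn : 0 < n) :
    ∃ (J : Fin (k + 1) → Fin n) (ε : ℝ), StrictMono J ∧
      ∀ i : Fin (k + 1), 0 < (-1) ^ (i : ℕ) * -Real.sin (J i * θ - ε) := by
  choose J hJ1 hJ2 using exists_mem_Ioc_nat_mul_pi hθ h hθ0 hn
  have hev : ∀ᶠ ε : ℝ in nhdsWithin 0 (Set.Ioi 0), ∀ i : Fin (k + 1),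
      ((i : ℝ) - 1) * Real.pi < J i * θ - ε := by
    refine Filter.eventually_all.2 fun i => ?_
    have hcont : Continuous fun ε : ℝ => J i * θ - ε := by fun_prop
    refine (hcont.tendsto 0).mono_left nhdsWithin_le_nhds |>.eventually_const_lt ?_
    simpa using hJ1 i
  obtain ⟨ε, hε, (hεpos : 0 < ε)⟩ := (hev.and self_mem_nhdsWithin).exists
  refine ⟨J, ε, fun a b hab => ?_, fun i => ?_⟩
  · have h1 : ((a : ℕ) : ℝ) + 1 ≤ (b : ℕ) := by exact_mod_cast hab
    have h2 : (J a : ℝ) * θ < J b * θ := by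
      refine (hJ2 a).trans_lt (lt_of_le_of_lt ?_ (hJ1 b))
      gcongr
      linarith
    exact_mod_cast lt_of_mul_lt_mul_right h2 hθ0.le
  · have := Real.sin_pos_of_pos_of_lt_pi (x := (i : ℕ) * Real.pi - (J i * θ - ε))
      (by linarith [hJ2 i]) (by linarith [hε i])
    rw [Real.sin_nat_mul_pi_sub] at this
    linarith

lemma im_exp_mul_pow (z : ℂ) (φ : ℝ) (j : ℕ) :
    (Complex.exp (φ * Complex.I) * z ^ j).im = ‖z‖ ^ j * Real.sin (j * z.arg + φ) := by
  conv_lhs => rw [← Complex.norm_mul_exp_arg_mul_I z]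
  rw [mul_pow, ← Complex.exp_nat_mul, mul_left_comm, ← Complex.exp_add, ← Complex.ofReal_pow,
    Complex.im_ofReal_mul, ← Complex.exp_ofReal_mul_I_im]
  congr 3
  push_cast
  ring

/-- if `V ⊆ ℂⁿ` is a `k`-dimensional totally nonnegative subspace and
`z ≠ 0` with `(1, z, …, z^{n−1}) ∈ V`, then `|arg z| ≤ (k−1)π/(n−1)`. -/
theorem arg_le_of_mem_tnn (k n : ℕ) (hk : 1 ≤ k) (hkn : k ≤ n) (hn : 2 ≤ n)
    (V : Submodule ℂ (Fin n → ℂ)) (hV : Module.finrank ℂ V = k)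
    (hTNN : IsTotallyNonneg k n V) (z : ℂ) (hz : z ≠ 0)
    (hmem : (fun j : Fin n => z ^ (j : ℕ)) ∈ V) :
    |Complex.arg z| ≤ ((k : ℝ) - 1) * Real.pi / ((n : ℝ) - 1) := by
  obtain ⟨A, hli, rfl, hA⟩ := hTNN
  have hn1 : (0 : ℝ) < (n : ℝ) - 1 := by
    have : (2 : ℝ) ≤ n := by exact_mod_cast hn
    linarith
  have hk1 : (0 : ℝ) ≤ (k : ℝ) - 1 := by
    have : (1 : ℝ) ≤ k := by exact_mod_cast hk
    linarith
  by_contra! hlt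
  rw [div_lt_iff₀ hn1, mul_comm |z.arg|] at hlt
  have hθ0 : 0 < |z.arg| :=
    pos_of_mul_pos_right ((mul_nonneg hk1 Real.pi_pos.le).trans_lt hlt) hn1.le
  obtain ⟨J, ε, hJ, halt⟩ :=
    exists_alternating_sin (Complex.abs_arg_le_pi z) hlt hθ0 (by omega)
  obtain ⟨g, hg, hdet⟩ := exists_strictMono_det_ne_zero (linearIndependent_row_of_rowsC hli)
  obtain ⟨a, ha⟩ : ∃ a : ℂ, ∀ j : ℕ,
      (a * z ^ j).im = ‖z‖ ^ j * -Real.sin (j * |z.arg| - ε) := by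
    rcases abs_choice z.arg with h | h
    · refine ⟨-Complex.exp ((-ε : ℝ) * Complex.I), fun j => ?_⟩
      rw [neg_mul, Complex.neg_im, im_exp_mul_pow, h, ← sub_eq_add_neg, mul_neg]
    · refine ⟨Complex.exp (ε * Complex.I), fun j => ?_⟩
      rw [im_exp_mul_pow, h, ← Real.sin_neg]
      ring_nf
  obtain ⟨c, hc⟩ := exists_vecMul_eq_im hmem a
  refine not_alternating_of_det_nonneg hA hJ hg ((hA g hg).lt_of_ne' hdet) c fun i => ?_
  rw [hc, ha, mul_left_comm]
  exact mul_pos (pow_pos (norm_pos_iff.2 hz) _) (halt i)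
end

section
/- Let 1 ≤ k ≤ n with n ≥ 2, and let z ∈ ℂ with z ≠ 0 and |arg(z)| ≤ (k−1)π/(n−1), where arg : ℂ× → (−π, π] is the principal argument. Then there exists a k-dimensional totally nonnegative subspace V ⊆ ℂⁿ with (1, z, z², …, z^{n−1}) ∈ V. -/
open scoped BigOperators

/-- A real matrix with nonnegative maximal minors, one of them positive, yields a totally
nonnegative subspace containing every complex combination of its rows. -/
theorem exists_tnn_of_matrix {k n : ℕ} (A : Matrix (Fin k) (Fin n) ℝ)
    (hA : ∀ g : Fin k → Fin n, StrictMono g → 0 ≤ (A.submatrix id g).det)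
    (g : Fin k → Fin n) (hg : (A.submatrix id g).det ≠ 0)
    (u : Fin n → ℂ) (c : Fin k → ℂ) (hc : ∀ j, ∑ p, c p * (A p j : ℂ) = u j) :
    ∃ V : Submodule ℂ (Fin n → ℂ), Module.finrank ℂ V = k ∧ IsTotallyNonneg k n V ∧ u ∈ V := by
  have hli : LinearIndependent ℂ (rowsC A) := by
    have hunit : IsUnit ((A.submatrix id g).map Complex.ofRealHom) := by
      rw [Matrix.isUnit_iff_isUnit_det, ← RingHom.mapMatrix_apply, ← RingHom.map_det]
      exact (isUnit_iff_ne_zero.mpr hg).map _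
    exact LinearIndependent.of_comp (LinearMap.funLeft ℂ ℂ g)
      (Matrix.linearIndependent_rows_iff_isUnit.mpr hunit)
  refine ⟨Submodule.span ℂ (Set.range (rowsC A)), ?_, ⟨A, hli, rfl, hA⟩, ?_⟩
  · simpa using finrank_span_eq_card hli
  · have hu : u = ∑ p, c p • rowsC A p := by
      funext j
      simp [← hc j, rowsC, Finset.sum_apply]
    rw [hu]
    exact Submodule.sum_mem _ fun p _ =>
      Submodule.smul_mem _ _ (Submodule.subset_span ⟨p, rfl⟩)

/-- The maximal minors of a column-scaled transposed projective Vandermonde matrix. -/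
theorem det_scaled_projVandermonde {k n : ℕ} (d v w : Fin n → ℝ) (g : Fin k → Fin n) :
    ((Matrix.of fun (p : Fin k) (j : Fin n) =>
      d j * (v j ^ (p : ℕ) * w j ^ (p.rev : ℕ))).submatrix id g).det =
      (∏ q, d (g q)) * ∏ i, ∏ j ∈ Finset.Ioi i, (v (g j) * w (g i) - v (g i) * w (g j)) := by
  have hdet := Matrix.det_projVandermonde (v ∘ g) (w ∘ g)
  rw [← Matrix.det_transpose] at hdet
  simp only [Function.comp_apply] at hdet
  rw [← hdet, ← Matrix.det_mul_row]
  rfl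

/-- Points on a projective line in weakly increasing order, the first `k` of them distinct, yield a
totally nonnegative subspace through their rational normal curve. -/
theorem exists_tnn_of_projective_points {k n : ℕ} (hkn : k ≤ n) (d v w : Fin n → ℝ)
    (hd : ∀ j, 0 < d j)
    (hvw : ∀ i j, i < j → 0 ≤ v j * w i - v i * w j)
    (hpos : ∀ i j : Fin n, i < j → (j : ℕ) < k → 0 < v j * w i - v i * w j)
    (u : Fin n → ℂ) (c : Fin k → ℂ)
    (hc : ∀ j, ∑ p, c p * ((d j * (v j ^ (p : ℕ) * w j ^ (p.rev : ℕ)) : ℝ) : ℂ) = u j) :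
    ∃ V : Submodule ℂ (Fin n → ℂ), Module.finrank ℂ V = k ∧ IsTotallyNonneg k n V ∧ u ∈ V := by
  refine exists_tnn_of_matrix
    (Matrix.of fun (p : Fin k) (j : Fin n) => d j * (v j ^ (p : ℕ) * w j ^ (p.rev : ℕ)))
    (fun g hg => ?_) (Fin.castLE hkn) ?_ u c hc
  · rw [det_scaled_projVandermonde]
    exact mul_nonneg (Finset.prod_nonneg fun q _ => (hd _).le)
      (Finset.prod_nonneg fun i _ => Finset.prod_nonneg fun j hj =>
        hvw _ _ (hg (Finset.mem_Ioi.mp hj)))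
  · rw [det_scaled_projVandermonde]
    refine (mul_pos (Finset.prod_pos fun q _ => hd _)
      (Finset.prod_pos fun i _ => Finset.prod_pos fun j hj => hpos _ _ ?_ j.isLt)).ne'
    exact (Fin.castLE_lt_castLE_iff hkn).mpr (Finset.mem_Ioi.mp hj)

/-- Binomial expansion of a power of `exp (ε α I)`, for a sign `ε`, in `sin α` and `cos α`. -/
theorem sum_choose_sin_cos {k : ℕ} (hk : 1 ≤ k) (ε α : ℝ) (hε : ε = 1 ∨ ε = -1) :
    ∑ p : Fin k, ((ε * Complex.I) ^ (p : ℕ) * ((k - 1).choose p : ℂ)) *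
        ((Real.sin α : ℂ) ^ (p : ℕ) * (Real.cos α : ℂ) ^ (p.rev : ℕ)) =
      Complex.exp (((k - 1 : ℕ) : ℂ) * (ε * α * Complex.I)) := by
  obtain ⟨m, rfl⟩ := Nat.exists_eq_add_of_le' hk
  have hexp : Complex.exp (ε * α * Complex.I) =
      ε * Complex.I * Real.sin α + Real.cos α := by
    rw [Complex.exp_mul_I]
    rcases hε with rfl | rfl <;> simp <;> ring
  rw [Complex.exp_nat_mul, hexp, add_pow, Nat.add_sub_cancel, ← Fin.sum_univ_eq_sum_range
    (fun p => (ε * Complex.I * Real.sin α) ^ p * (Real.cos α : ℂ) ^ (m - p) * (m.choose p : ℂ))]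
  refine Finset.sum_congr rfl fun p _ => ?_
  rw [Fin.val_rev, Nat.add_sub_add_right]
  ring

/-- conversely, for any `z ≠ 0` with `|arg z| ≤ (k−1)π/(n−1)` there is a
`k`-dimensional totally nonnegative subspace `V ⊆ ℂⁿ` with `(1, z, …, z^{n−1}) ∈ V`. -/
theorem exists_tnn_of_arg_le (k n : ℕ) (hk : 1 ≤ k) (hkn : k ≤ n) (hn : 2 ≤ n)
    (z : ℂ) (hz : z ≠ 0)
    (harg : |Complex.arg z| ≤ ((k : ℝ) - 1) * Real.pi / ((n : ℝ) - 1)) :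
    ∃ V : Submodule ℂ (Fin n → ℂ), Module.finrank ℂ V = k ∧
      IsTotallyNonneg k n V ∧ (fun j : Fin n => z ^ (j : ℕ)) ∈ V := by
  rcases hkn.eq_or_lt with rfl | hlt
  · refine exists_tnn_of_matrix 1 (fun g hg => ?_) id (by simp) _ (fun j => z ^ (j : ℕ)) fun j => ?_
    · have hid : g = id := by
        funext i
        exact congrFun (congrArg DFunLike.coe
          (Subsingleton.elim (hg.orderIsoOfSurjective g
            (Finite.surjective_of_injective hg.injective)) (OrderIso.refl _))) i
      simp [hid]
    · simp [Matrix.one_apply, apply_ite Complex.ofReal]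
  have hr : 0 < ‖z‖ := norm_pos_iff.mpr hz
  have hn1 : (0 : ℝ) < (n : ℝ) - 1 := by
    have : (2 : ℝ) ≤ n := by exact_mod_cast hn
    linarith
  by_cases hθ : z.arg = 0
  · have hzr : (‖z‖ : ℂ) = z := by
      simpa [hθ] using Complex.norm_mul_exp_arg_mul_I z
    obtain ⟨m, rfl⟩ := Nat.exists_eq_add_of_le' hk
    refine exists_tnn_of_projective_points hkn (fun j => ‖z‖ ^ (j : ℕ)) (fun j => (j : ℝ))
      (fun _ => 1) (fun j => by positivity) (fun i j hij => ?_) (fun i j hij _ => ?_) _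
      (Pi.single 0 1) fun j => ?_
    · have : (i : ℝ) < j := by exact_mod_cast hij
      simpa using this.le
    · have : (i : ℝ) < j := by exact_mod_cast hij
      simpa using this
    · simp [Pi.single_apply, hzr]
  have hk2 : 2 ≤ k := by
    by_contra! h
    obtain rfl : k = 1 := by omega
    exact hθ (abs_nonpos_iff.mp (by simpa using harg))
  have hk1 : (0 : ℝ) < (k : ℝ) - 1 := by
    have : (2 : ℝ) ≤ k := by exact_mod_cast hk2
    linarith
  obtain ⟨ε, hε, hεθ⟩ : ∃ ε : ℝ, (ε = 1 ∨ ε = -1) ∧ ε * |z.arg| = z.arg := by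
    rcases abs_cases z.arg with ⟨h, _⟩ | ⟨h, _⟩
    · exact ⟨1, Or.inl rfl, by rw [h, one_mul]⟩
    · exact ⟨-1, Or.inr rfl, by rw [h]; ring⟩
  set α : ℝ := |z.arg| / ((k : ℝ) - 1) with hα
  have hα0 : 0 < α := div_pos (abs_pos.mpr hθ) hk1
  have hαn : α * ((n : ℝ) - 1) ≤ Real.pi := by
    rw [le_div_iff₀ hn1] at harg
    rw [hα, div_mul_eq_mul_div, div_le_iff₀ hk1]
    linarith
  have hdiff : ∀ i j : Fin n,
      Real.sin (j * α) * Real.cos (i * α) - Real.sin (i * α) * Real.cos (j * α) =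
        Real.sin (((j : ℝ) - i) * α) := by
    intro i j
    rw [sub_mul, Real.sin_sub]
    ring
  refine exists_tnn_of_projective_points hkn (fun j => ‖z‖ ^ (j : ℕ))
    (fun j => Real.sin (j * α)) (fun j => Real.cos (j * α)) (fun j => by positivity)
    (fun i j hij => ?_) (fun i j hij hjk => ?_) _
    (fun p => (ε * Complex.I) ^ (p : ℕ) * ((k - 1).choose p : ℂ)) fun j => ?_
  · rw [hdiff]
    have hij' : (i : ℝ) < j := by exact_mod_cast hij
    have hjn : (j : ℝ) + 1 ≤ n := by exact_mod_cast j.isLt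
    have hi : (0 : ℝ) ≤ i := Nat.cast_nonneg _
    exact Real.sin_nonneg_of_nonneg_of_le_pi (mul_nonneg (by linarith) hα0.le) (by nlinarith)
  · rw [hdiff]
    have hij' : (i : ℝ) < j := by exact_mod_cast hij
    have hjn : (j : ℝ) + 1 < n := by exact_mod_cast (show (j : ℕ) + 1 < n by omega)
    have hi : (0 : ℝ) ≤ i := Nat.cast_nonneg _
    exact Real.sin_pos_of_pos_of_lt_pi (mul_pos (by linarith) hα0) (by nlinarith)
  · have hsum := sum_choose_sin_cos hk ε (j * α) hε
    have harg' : ((k - 1 : ℕ) : ℂ) * (ε * ((j * α : ℝ) : ℂ) * Complex.I) =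
        (j : ℕ) * (z.arg * Complex.I) := by
      have hreal : ((k : ℝ) - 1) * (ε * α) = z.arg := by
        rw [← hεθ, hα]
        field_simp
      rw [← hreal, Nat.cast_sub hk]
      push_cast
      ring
    rw [harg', Complex.exp_nat_mul] at hsum
    calc _ = (‖z‖ : ℂ) ^ (j : ℕ) * ∑ p : Fin k,
          ((ε * Complex.I) ^ (p : ℕ) * ((k - 1).choose p : ℂ)) *
          ((Real.sin (j * α) : ℂ) ^ (p : ℕ) * (Real.cos (j * α) : ℂ) ^ (p.rev : ℕ)) := by
          rw [Finset.mul_sum]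
          refine Finset.sum_congr rfl fun p _ => ?_
          push_cast
          ring
      _ = z ^ (j : ℕ) := by
          rw [hsum, ← mul_pow, Complex.norm_mul_exp_arg_mul_I]
end
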